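/- arXiv:0904.3835 — 5 statements merged into one kernel-verified Lean document; each statement's English description precedes it below -/
import Mathlib

section
/- Let ρ ≥ 1 be an integer, let q' be a prime power, let q = (q')^{ρ+1}, and let v > ρ+1. Then the space PG(v,q) contains a ρ-saturating set of size (V_{q'}(v+1, v−ρ+1) − 1)/(q'−1). -/
noncomputable section

/-- `S` is a `ρ`-saturating set of points of the projective space `PG(m-1, F)`
(projectivization of `F^m`): every point lies in the projective subspace generated by
some `ρ+1` points of `S`. -/
def IsSaturating (F : Type*) [Field F] (m ρ : ℕ)
    (S : Set (Projectivization F (Fin m → F))) : Prop :=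
  ∀ P : Projectivization F (Fin m → F),
    ∃ p : Fin (ρ + 1) → Projectivization F (Fin m → F),
      (∀ i, p i ∈ S) ∧
        P.rep ∈ Submodule.span F (Set.range (fun i => (p i).rep))

/-- `B` is a `t`-fold strong blocking set of `PG(m-1, F)`: every `t`-dimensional
linear subspace of `F^m` (i.e. every `(t-1)`-dimensional projective subspace)
is the span of `t` points of `B`. -/
def IsStrongBlocking (F : Type*) [Field F] (m t : ℕ)
    (B : Set (Projectivization F (Fin m → F))) : Prop :=
  ∀ W : Submodule F (Fin m → F), Module.finrank F W = t →
    ∃ p : Fin t → Projectivization F (Fin m → F),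
      (∀ i, p i ∈ B) ∧
        Submodule.span F (Set.range (fun i => (p i).rep)) = W

/-- `B` is a `t`-fold blocking set of `PG(m-1, F)`:
every line meets `B` in at least `t` points. -/
def IsBlocking (F : Type*) [Field F] (m t : ℕ)
    (B : Set (Projectivization F (Fin m → F))) : Prop :=
  ∀ W : Submodule F (Fin m → F), Module.finrank F W = 2 →
    t ≤ {P | P ∈ B ∧ P.rep ∈ W}.ncard

/-- The embedding of the subgeometry `PG(m-1, K)` into `PG(m-1, L)`, induced by applying
the inclusion `K ↪ L` coordinatewise to representative vectors. -/
def subgeom {m : ℕ} (K L : Type*) [Field K] [Field L] [Algebra K L]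
    (P : Projectivization K (Fin m → K)) : Projectivization L (Fin m → L) :=
  Projectivization.mk L (fun i => algebraMap K L (P.rep i))
    (by
      intro h
      apply P.rep_nonzero
      funext i
      have hi : algebraMap K L (P.rep i) = 0 := congrFun h i
      exact (algebraMap K L).injective (by simpa using hi))

/-- The linear code `C` has covering radius exactly `R`: every vector is within Hamming
distance `R` of a codeword, and `R` is the least such value. -/
def IsCovRadius {F : Type*} [Field F] [DecidableEq F] {n : ℕ}
    (C : Submodule F (Fin n → F)) (R : ℕ) : Prop :=
  (∀ x : Fin n → F, ∃ c ∈ C, hammingDist x c ≤ R) ∧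
  (∃ x : Fin n → F, ∀ c ∈ C, R ≤ hammingDist x c)

/-- There exists a linear `[n, n-r]` code over `F` with covering radius `R`. -/
def ExistsCovCode (F : Type*) [Field F] [DecidableEq F] (n r R : ℕ) : Prop :=
  r ≤ n ∧ ∃ C : Submodule F (Fin n → F),
    Module.finrank F C = n - r ∧ IsCovRadius C R

/-- `V_q(n,R)`: the cardinality of a Hamming sphere of radius `R` in `F_q^n`. -/
def sphereCard (q n R : ℕ) : ℕ :=
  ∑ i ∈ Finset.range (R + 1), (q - 1) ^ i * n.choose i

theorem Submodule.exists_le_finrank_eq {K V : Type*} [Field K] [AddCommGroup V] [Module K V]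
    [FiniteDimensional K V] (W : Submodule K V) {t : ℕ} (hW : Module.finrank K W ≤ t)
    (ht : t ≤ Module.finrank K V) :
    ∃ W' : Submodule K V, W ≤ W' ∧ Module.finrank K W' = t := by
  induction t, hW using Nat.le_induction with
  | base => exact ⟨W, le_rfl, rfl⟩
  | succ t _ ih =>
    obtain ⟨U, hWU, hU⟩ := ih (by omega)
    obtain ⟨x, hx⟩ := U.exists_of_finrank_lt (by omega)
    have hxU : x ∉ U := by simpa using hx 1 one_ne_zero
    refine ⟨U ⊔ K ∙ x, hWU.trans le_sup_left, ?_⟩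
    rw [Submodule.finrank_sup_span_singleton hxU, hU]

/-- Every `t`-dimensional space of vectors of length `n` is spanned by `t` nonzero vectors of
Hamming weight at most `n - t + 1` (the rows of a generator matrix in reduced echelon form). -/
theorem Submodule.exists_span_eq_hammingNorm_le {K : Type*} [Field K] [DecidableEq K] {n t : ℕ}
    (W : Submodule K (Fin n → K)) (hW : Module.finrank K W = t) :
    ∃ w : Fin t → Fin n → K, (∀ i, w i ≠ 0) ∧ (∀ i, hammingNorm (w i) + t ≤ n + 1) ∧
      Submodule.span K (Set.range w) = W := by
  let f : Fin n → Module.Dual K W := fun j => (LinearMap.proj j).comp W.subtype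
  have hf : Submodule.span K (Set.range f) = ⊤ := by
    have hbot : (Submodule.span K (Set.range f)).dualCoannihilator = ⊥ := by
      refine (Submodule.eq_bot_iff _).2 fun x hx => ?_
      rw [Submodule.mem_dualCoannihilator] at hx
      ext j
      exact hx (f j) (Submodule.subset_span ⟨j, rfl⟩)
    rw [← Subspace.dualCoannihilator_dualAnnihilator_eq (W := Submodule.span K (Set.range f)),
      hbot, Submodule.dualAnnihilator_bot]
  have hd : Module.finrank K (Submodule.span K (Set.range f)) = t := by
    rw [hf, finrank_top, Subspace.dual_finrank_eq, hW]
  obtain ⟨g, hg, hgs⟩ : ∃ g : Fin t → Module.Dual K W, (∀ i, g i ∈ Set.range f) ∧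
      Submodule.span K (Set.range g) = ⊤ := by
    obtain ⟨g, hg, hgs, -⟩ := Submodule.exists_fun_fin_finrank_span_eq K (Set.range f)
    subst hd
    exact ⟨g, hg, hgs.trans hf⟩
  choose c hc using hg
  have hinj : Function.Injective (LinearMap.pi g) := by
    rw [← LinearMap.ker_eq_bot, Submodule.eq_bot_iff]
    intro x hx
    rw [← Module.forall_dual_apply_eq_zero_iff K]
    intro φ
    have hφ : φ ∈ Submodule.span K (Set.range g) := hgs ▸ Submodule.mem_top
    induction hφ using Submodule.span_induction with
    | mem φ h => obtain ⟨i, rfl⟩ := h; exact congrFun hx i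
    | zero => rfl
    | add φ ψ _ _ hφ hψ => simp [hφ, hψ]
    | smul a φ _ hφ => simp [hφ]
  let e : W ≃ₗ[K] (Fin t → K) :=
    LinearEquiv.ofInjectiveOfFinrankEq _ hinj (by simp [hW])
  let b : Module.Basis (Fin t) K W := Module.Basis.ofEquivFun e
  have hb : ∀ i j, (b i : Fin n → K) (c j) = if j = i then 1 else 0 := by
    intro i j
    have h1 : e (b i) j = if j = i then 1 else 0 := by
      simp [b, Pi.single_apply]
    rw [← h1]
    change f (c j) (b i) = g j (b i)
    rw [hc]
  have hci : Function.Injective c := by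
    intro i j hij
    have h1 := hb i i
    rw [hij, hb i j] at h1
    by_contra h
    simp [Ne.symm h] at h1
  refine ⟨fun i => b i, fun i => ?_, fun i => ?_, ?_⟩
  · simpa using b.ne_zero i
  · have hsub : (Finset.univ.erase i).map ⟨c, hci⟩ ⊆
        (Finset.univ.filter fun j => (b i : Fin n → K) j ≠ 0)ᶜ := by
      intro j hj
      simp only [Finset.mem_map, Finset.mem_erase] at hj
      obtain ⟨k, ⟨hk, -⟩, rfl⟩ := hj
      simp [hb, hk]
    have hcard := Finset.card_le_card hsub
    rw [Finset.card_map, Finset.card_erase_of_mem (Finset.mem_univ i), Finset.card_compl,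
      Finset.card_univ, Fintype.card_fin, Fintype.card_fin] at hcard
    have hle : hammingNorm (b i : Fin n → K) ≤ n := by
      simpa using hammingNorm_le_card_fintype (x := (b i : Fin n → K))
    have hi := i.pos
    simp only [hammingNorm] at hle ⊢
    omega
  · have := congrArg (Submodule.map W.subtype) b.span_eq
    rw [Submodule.map_span, Submodule.map_top, Submodule.range_subtype, ← Set.range_comp] at this
    exact this

/-- Applying the inclusion `K ↪ L` coordinatewise, as a semilinear map. -/
def coordMap (K L : Type*) [Field K] [Field L] [Algebra K L] (n : ℕ) :
    (Fin n → K) →ₛₗ[algebraMap K L] (Fin n → L) where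
  toFun x i := algebraMap K L (x i)
  map_add' x y := by ext; simp
  map_smul' a x := by ext; simp

theorem coordMap_injective (K L : Type*) [Field K] [Field L] [Algebra K L] (n : ℕ) :
    Function.Injective (coordMap K L n) := fun _ _ h =>
  funext fun i => (algebraMap K L).injective (congrFun h i)

theorem map_coordMap_injective (K L : Type*) [Field K] [Field L] [Algebra K L] (n : ℕ) :
    Function.Injective (Projectivization.map (coordMap K L n) (coordMap_injective K L n)) := by
  intro P Q h
  induction P using Projectivization.ind with | h u hu =>
  induction Q using Projectivization.ind with | h v hv =>
  simp only [Projectivization.map_mk, Projectivization.mk_eq_mk_iff'] at h ⊢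
  obtain ⟨a, ha⟩ := h
  obtain ⟨j, hj⟩ := Function.ne_iff.1 hv
  have hj' : algebraMap K L (v j) ≠ 0 := by simpa using hj
  have hi : ∀ i, a * algebraMap K L (v i) = algebraMap K L (u i) := fun i => congrFun ha i
  have haj : a = algebraMap K L (u j / v j) := by
    rw [map_div₀, eq_div_iff hj', hi]
  refine ⟨u j / v j, coordMap_injective K L n ?_⟩
  rw [LinearMap.map_smulₛₗ, ← haj, ha]

theorem coordMap_mem_span {K L : Type*} [Field K] [Field L] [Algebra K L] {n : ℕ}
    {s : Set (Fin n → K)} {y : Fin n → K} (hy : y ∈ Submodule.span K s) :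
    coordMap K L n y ∈ Submodule.span L (coordMap K L n '' s) := by
  induction hy using Submodule.span_induction with
  | mem y h => exact Submodule.subset_span ⟨y, h, rfl⟩
  | zero => simp
  | add y z _ _ hy hz => rw [map_add]; exact add_mem hy hz
  | smul a y _ hy => rw [LinearMap.map_smulₛₗ]; exact Submodule.smul_mem _ _ hy

/-- A vector of length `n ≥ t` over an extension `L / K` of degree `t` is an `L`-combination of `t`
nonzero vectors over `K` of Hamming weight at most `n - t + 1`. -/
theorem exists_mem_span_coordMap {K L : Type*} [Field K] [DecidableEq K] [Field L] [Algebra K L]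
    [FiniteDimensional K L] {n t : ℕ} (ht : Module.finrank K L = t) (htn : t ≤ n)
    (x : Fin n → L) :
    ∃ w : Fin t → Fin n → K, (∀ i, w i ≠ 0) ∧ (∀ i, hammingNorm (w i) + t ≤ n + 1) ∧
      x ∈ Submodule.span L (Set.range fun i => coordMap K L n (w i)) := by
  let b := Module.finBasisOfFinrankEq K L ht
  let y : Fin t → Fin n → K := fun i j => b.repr (x j) i
  obtain ⟨W, hyW, hW⟩ := (Submodule.span K (Set.range y)).exists_le_finrank_eq
    (t := t) (by simpa [Set.finrank] using finrank_range_le_card (R := K) y) (by simpa using htn)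
  obtain ⟨w, hw0, hwt, hws⟩ := W.exists_span_eq_hammingNorm_le hW
  refine ⟨w, hw0, hwt, ?_⟩
  have hx : x = ∑ i, b i • coordMap K L n (y i) := by
    ext j
    conv_lhs => rw [← b.sum_repr (x j)]
    simp [coordMap, y, Algebra.smul_def, mul_comm]
  rw [hx]
  refine Submodule.sum_mem _ fun i _ => Submodule.smul_mem _ _ ?_
  have hy : y i ∈ Submodule.span K (Set.range w) :=
    hws ▸ hyW (Submodule.subset_span ⟨i, rfl⟩)
  simpa [← Set.range_comp, Function.comp_def] using coordMap_mem_span (L := L) hy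

theorem card_hammingNorm_eq {K : Type*} [Field K] [Fintype K] [DecidableEq K] (n i : ℕ) :
    (Finset.univ.filter fun x : Fin n → K => hammingNorm x = i).card =
      (Fintype.card K - 1) ^ i * n.choose i := by
  have hmap : ∀ x ∈ Finset.univ.filter fun x : Fin n → K => hammingNorm x = i,
      (Finset.univ.filter fun j => x j ≠ 0) ∈
        Finset.powersetCard i (Finset.univ : Finset (Fin n)) := by
    intro x hx
    simpa [Finset.mem_powersetCard, hammingNorm] using hx
  rw [Finset.card_eq_sum_card_fiberwise hmap]
  have hfib : ∀ s ∈ Finset.powersetCard i (Finset.univ : Finset (Fin n)),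
      ((Finset.univ.filter fun x : Fin n → K => hammingNorm x = i).filter
        fun x => (Finset.univ.filter fun j => x j ≠ 0) = s).card =
          (Fintype.card K - 1) ^ i := by
    intro s hs
    have hsi := (Finset.mem_powersetCard.1 hs).2
    have heq : ((Finset.univ.filter fun x : Fin n → K => hammingNorm x = i).filter
        fun x => (Finset.univ.filter fun j => x j ≠ 0) = s) =
        Fintype.piFinset fun j => if j ∈ s then Finset.univ.erase (0 : K) else {0} := by
      ext x
      simp only [Finset.mem_filter, Finset.mem_univ, true_and, Fintype.mem_piFinset]
      constructor
      · rintro ⟨-, rfl⟩ j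
        by_cases hj : x j = 0 <;> simp [hj]
      · intro h
        have hxs : (Finset.univ.filter fun j => x j ≠ 0) = s := by
          ext j
          have := h j
          by_cases hj : j ∈ s <;> simp_all
        exact ⟨by rw [hammingNorm, hxs, hsi], hxs⟩
    rw [heq, Fintype.card_piFinset]
    simp only [apply_ite Finset.card, Finset.card_singleton,
      Finset.card_erase_of_mem (Finset.mem_univ (0 : K)), Finset.card_univ]
    rw [Finset.prod_ite, Finset.prod_const, Finset.prod_const_one, mul_one]
    simp [hsi]
  rw [Finset.sum_congr rfl hfib, Finset.sum_const, Finset.card_powersetCard, Finset.card_univ,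
    Fintype.card_fin, smul_eq_mul, mul_comm]

theorem card_hammingNorm_le {K : Type*} [Field K] [Fintype K] [DecidableEq K] (n R : ℕ) :
    (Finset.univ.filter fun x : Fin n → K => hammingNorm x ≤ R).card =
      sphereCard (Fintype.card K) n R := by
  have hmap : ∀ x ∈ Finset.univ.filter fun x : Fin n → K => hammingNorm x ≤ R,
      hammingNorm x ∈ Finset.range (R + 1) := by
    intro x hx
    simpa [Nat.lt_succ_iff] using hx
  rw [Finset.card_eq_sum_card_fiberwise hmap, sphereCard]
  refine Finset.sum_congr rfl fun i hi => ?_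
  rw [← card_hammingNorm_eq, Finset.filter_filter]
  congr 1
  ext x
  simp only [Finset.mem_filter, Finset.mem_univ, true_and, and_iff_right_iff_imp]
  rintro rfl
  simpa [Nat.lt_succ_iff] using hi

theorem hammingNorm_units_smul {K : Type*} [Field K] [DecidableEq K] {n : ℕ} (a : Kˣ)
    (x : Fin n → K) : hammingNorm (a • x) = hammingNorm x := by
  simp [hammingNorm, Units.smul_def]

/-- The points of `PG(n-1, K)` of weight at most `R`. -/
def lowWeightPoints (K : Type*) [Field K] [DecidableEq K] (n R : ℕ) :
    Set (Projectivization K (Fin n → K)) :=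
  {P | hammingNorm P.rep ≤ R}

theorem mk_mem_lowWeightPoints {K : Type*} [Field K] [DecidableEq K] {n R : ℕ}
    {x : Fin n → K} (hx : x ≠ 0) :
    Projectivization.mk K x hx ∈ lowWeightPoints K n R ↔ hammingNorm x ≤ R := by
  obtain ⟨a, ha⟩ := Projectivization.exists_smul_eq_mk_rep K x hx
  rw [lowWeightPoints, Set.mem_ofPred_eq, ← ha, hammingNorm_units_smul]

theorem ncard_lowWeightPoints (K : Type*) [Field K] [Fintype K] [DecidableEq K] (n R : ℕ) :
    (lowWeightPoints K n R).ncard =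
      (sphereCard (Fintype.card K) n R - 1) / (Fintype.card K - 1) := by
  let A := (Finset.univ.filter fun x : Fin n → K => hammingNorm x ≤ R).erase 0
  have hA : A.card = sphereCard (Fintype.card K) n R - 1 := by
    rw [Finset.card_erase_of_mem (by simp), card_hammingNorm_le]
  let F : lowWeightPoints K n R × Kˣ → A := fun p =>
    ⟨p.2 • p.1.1.rep, by
      have h : hammingNorm p.1.1.rep ≤ R := p.1.2
      simp only [A, Finset.mem_erase, Finset.mem_filter, Finset.mem_univ, true_and,
        hammingNorm_units_smul]
      exact ⟨(smul_ne_zero_iff_ne _).2 p.1.1.rep_nonzero, h⟩⟩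
  have hF : Function.Bijective F := by
    constructor
    · rintro ⟨⟨P, hP⟩, a⟩ ⟨⟨Q, hQ⟩, b⟩ h
      have h' : a • P.rep = b • Q.rep := congrArg Subtype.val h
      have hPQ : P = Q := by
        rw [← P.mk_rep, ← Q.mk_rep, Projectivization.mk_eq_mk_iff]
        exact ⟨a⁻¹ * b, by rw [mul_smul, ← h', inv_smul_smul]⟩
      subst hPQ
      have hab : (a : K) = b := smul_left_injective K P.rep_nonzero h'
      rw [Units.ext hab]
    · rintro ⟨x, hx⟩
      obtain ⟨hx0, hxR⟩ : x ≠ 0 ∧ hammingNorm x ≤ R := by simpa [A] using hx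
      obtain ⟨a, ha⟩ := Projectivization.exists_smul_eq_mk_rep K x hx0
      refine ⟨⟨⟨Projectivization.mk K x hx0, (mk_mem_lowWeightPoints hx0).2 hxR⟩, a⁻¹⟩, ?_⟩
      apply Subtype.ext
      simp only [F, ← ha, inv_smul_smul]
  have hcard := Nat.card_congr (Equiv.ofBijective F hF)
  rw [Nat.card_prod, Nat.card_coe_set_eq, Nat.card_eq_fintype_card (α := Kˣ),
    Fintype.card_units, Nat.card_eq_fintype_card, Fintype.card_coe, hA] at hcard
  have hK : 1 < Fintype.card K := Fintype.one_lt_card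
  rw [← hcard, Nat.mul_div_cancel _ (by omega)]

theorem isSaturating_image_lowWeightPoints {K L : Type*} [Field K] [DecidableEq K] [Field L]
    [Algebra K L] [FiniteDimensional K L] {n ρ R : ℕ} (hρ : Module.finrank K L = ρ + 1)
    (hn : ρ + 1 ≤ n) (hR : n ≤ R + ρ) :
    IsSaturating L n ρ (Projectivization.map (coordMap K L n) (coordMap_injective K L n) ''
      lowWeightPoints K n R) := by
  intro P
  obtain ⟨w, hw0, hwt, hw⟩ := exists_mem_span_coordMap hρ hn P.rep
  refine ⟨fun i => Projectivization.map (coordMap K L n) (coordMap_injective K L n)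
    (Projectivization.mk K (w i) (hw0 i)), fun i => ⟨_, ?_, rfl⟩, ?_⟩
  · rw [mk_mem_lowWeightPoints]
    have := hwt i
    omega
  · refine Submodule.span_le.2 ?_ hw
    rintro _ ⟨i, rfl⟩
    rw [SetLike.mem_coe]
    simp only [Projectivization.map_mk]
    have hne : coordMap K L n (w i) ≠ 0 :=
      (map_ne_zero_iff _ (coordMap_injective K L n)).2 (hw0 i)
    obtain ⟨a, ha⟩ := Projectivization.exists_smul_eq_mk_rep L _ hne
    rw [← inv_smul_smul a (coordMap K L n (w i)), ha]
    exact Submodule.smul_mem _ ((a⁻¹ : Lˣ) : L) (Submodule.subset_span ⟨i, rfl⟩)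

/-- A finite field with `q ^ t` elements is an extension of degree `t` of a field with `q`
elements. -/
theorem exists_subfield_of_card_eq_pow {q t : ℕ} (hq : IsPrimePow q) (L : Type*)
    [Field L] [Fintype L] (hL : Fintype.card L = q ^ t) :
    ∃ (K : Type) (_ : Field K) (_ : Fintype K) (_ : Algebra K L),
      Fintype.card K = q ∧ Module.finrank K L = t := by
  obtain ⟨p, k, hp, hk, rfl⟩ := (isPrimePow_nat_iff _).1 hq
  have : Fact p.Prime := ⟨hp⟩
  have : CharP L p := charP_of_card_eq_prime_pow (f := k * t) (by rw [hL, pow_mul])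
  let _ : Algebra (ZMod p) L := ZMod.algebra L p
  have hfL : Module.finrank (ZMod p) L = k * t :=
    Nat.pow_right_injective hp.two_le
      ((FiniteField.pow_finrank_eq_card p L).trans (hL.trans (pow_mul p k t).symm))
  have hfK := GaloisField.finrank p hk.ne'
  obtain ⟨φ⟩ := FiniteField.nonempty_algHom_of_finrank_dvd (F := ZMod p)
    (K := GaloisField p k) (L := L) (by rw [hfK, hfL]; exact dvd_mul_right k t)
  let _ : Algebra (GaloisField p k) L := φ.toRingHom.toAlgebra
  let _ : Fintype (GaloisField p k) := Fintype.ofFinite _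
  have hK : Fintype.card (GaloisField p k) = p ^ k := by
    rw [← Nat.card_eq_fintype_card, GaloisField.card p k hk.ne']
  refine ⟨GaloisField p k, inferInstance, inferInstance, inferInstance, hK, ?_⟩
  have h := Module.card_eq_pow_finrank (K := GaloisField p k) (V := L)
  rw [hK, hL] at h
  exact (Nat.pow_right_injective hq.two_le h).symm

/-- Theorem 15. For `q = q'^{ρ+1}` and `v > ρ+1`, the space `PG(v,q)`
contains a `ρ`-saturating set of size `(V_{q'}(v+1, v-ρ+1) - 1)/(q'-1)`. -/
theorem statement11 (ρ : ℕ) (hρ : 1 ≤ ρ) (q' v : ℕ) (hq' : IsPrimePow q')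
    (hv : ρ + 1 < v)
    (L : Type*) [Field L] [Fintype L] (hL : Fintype.card L = q' ^ (ρ + 1)) :
    ∃ S : Set (Projectivization L (Fin (v + 1) → L)),
      IsSaturating L (v + 1) ρ S ∧
      S.ncard = (sphereCard q' (v + 1) (v - ρ + 1) - 1) / (q' - 1) := by
  classical
  obtain ⟨K, _, _, _, hK, hρ'⟩ := exists_subfield_of_card_eq_pow hq' L hL
  have : FiniteDimensional K L := Module.Finite.of_finite
  refine ⟨_, isSaturating_image_lowWeightPoints (R := v - ρ + 1) hρ' (by omega) (by omega), ?_⟩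
  rw [Set.ncard_image_of_injective _ (map_coordMap_injective K L (v + 1)),
    ncard_lowWeightPoints, hK]
end
end

section
/- Let q be a prime power, let R ≥ 2 and m ≥ 1 be integers, let r_0 be an integer, and suppose that there exists a linear [n_0, n_0−r_0]_q code with covering radius R for some n_0, so that the length function ℓ_q(r_0,R) is well defined. If q^m + 1 ≥ ℓ_q(r_0,R), then ℓ_q(r_0 + Rm, R) ≤ q^m · ℓ_q(r_0,R) + R·(q^m − 1)/(q − 1). -/
noncomputable section

/-- The columns `h` form a parity-check matrix with covering radius `R`: every syndrome is a
combination of at most `R` columns, and some syndrome needs at least `R` of them. -/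
def HasSyndromeRadius (F : Type*) [Field F] [DecidableEq F] {ι V : Type*} [Fintype ι]
    [AddCommGroup V] [Module F V] (h : ι → V) (R : ℕ) : Prop :=
  (∀ v, ∃ x : ι → F, Fintype.linearCombination F h x = v ∧ hammingNorm x ≤ R) ∧
    ∃ v, ∀ x : ι → F, Fintype.linearCombination F h x = v → R ≤ hammingNorm x

section Syndromes

variable {F : Type*} [Field F] [DecidableEq F] {ι κ V : Type*} [Fintype ι] [Fintype κ]
  [AddCommGroup V] [Module F V]

lemma hammingNorm_comp_equiv (e : ι ≃ κ) (x : κ → F) :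
    hammingNorm (x ∘ e) = hammingNorm x := by
  unfold hammingNorm
  exact Finset.card_equiv e (by simp)

lemma hammingDist_eq_hammingNorm_sub (x y : ι → F) : hammingDist x y = hammingNorm (x - y) := by
  rw [hammingDist_comm, hammingDist_eq_hammingNorm, neg_add_eq_sub]

omit [DecidableEq F] in
lemma linearCombination_comp_equiv (e : ι ≃ κ) (h : κ → V) (x : κ → F) :
    Fintype.linearCombination F (h ∘ e) (x ∘ e) = Fintype.linearCombination F h x := by
  simpa [Fintype.linearCombination_apply] using e.sum_comp fun i => x i • h i

lemma HasSyndromeRadius.comp_equiv {h : κ → V} {R : ℕ} (hh : HasSyndromeRadius F h R)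
    (e : ι ≃ κ) : HasSyndromeRadius F (h ∘ e) R := by
  obtain ⟨hcov, v, hv⟩ := hh
  refine ⟨fun w => ?_, v, fun x hx => ?_⟩
  · obtain ⟨x, hx, hxR⟩ := hcov w
    exact ⟨x ∘ e, by rw [linearCombination_comp_equiv, hx], by rwa [hammingNorm_comp_equiv]⟩
  · have hxe : x = (x ∘ e.symm) ∘ e := by ext; simp
    rw [hxe] at hx ⊢
    rw [linearCombination_comp_equiv] at hx
    rw [hammingNorm_comp_equiv]
    exact hv _ hx

lemma HasSyndromeRadius.existsCovCode [Module.Finite F V] {h : ι → V} {R : ℕ}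
    (hh : HasSyndromeRadius F h R) :
    ExistsCovCode F (Fintype.card ι) (Module.finrank F V) R := by
  obtain ⟨hcov, v, hv⟩ := hh.comp_equiv (Fintype.equivFin ι).symm
  set φ := Fintype.linearCombination F (h ∘ (Fintype.equivFin ι).symm)
  have hsurj : Function.Surjective φ := fun w => (hcov w).imp fun _ => And.left
  have hrank := φ.finrank_range_add_finrank_ker
  rw [LinearMap.range_eq_top.2 hsurj, finrank_top, Module.finrank_fin_fun] at hrank
  refine ⟨by omega, LinearMap.ker φ, by omega, fun x => ?_, ?_⟩
  · obtain ⟨y, hy, hyR⟩ := hcov (φ x)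
    refine ⟨x - y, by simp [LinearMap.mem_ker, hy], ?_⟩
    rwa [hammingDist_eq_hammingNorm_sub, sub_sub_cancel]
  · obtain ⟨x, rfl⟩ := hsurj v
    refine ⟨x, fun c hc => ?_⟩
    rw [hammingDist_eq_hammingNorm_sub]
    exact hv _ (by simp [LinearMap.mem_ker.1 hc])

lemma exists_hasSyndromeRadius {n r R : ℕ} (hex : ExistsCovCode F n r R) :
    ∃ C : Submodule F (Fin n → F), ∃ h : Fin n → (Fin n → F) ⧸ C,
      Module.finrank F ((Fin n → F) ⧸ C) = r ∧ HasSyndromeRadius F h R := by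
  obtain ⟨hrn, C, hC, hcov, x₀, hx₀⟩ := hex
  have hφ : Fintype.linearCombination F (fun i => C.mkQ (Pi.single i 1)) = C.mkQ := by
    ext i
    simp [Fintype.linearCombination_apply_single]
  refine ⟨C, fun i => C.mkQ (Pi.single i 1), ?_, ?_⟩
  · have := C.finrank_quotient_add_finrank
    rw [Module.finrank_fin_fun] at this
    omega
  · unfold HasSyndromeRadius
    rw [hφ]
    refine ⟨fun v => ?_, C.mkQ x₀, fun x hx => ?_⟩
    · obtain ⟨x, rfl⟩ := C.mkQ_surjective v
      obtain ⟨c, hc, hcR⟩ := hcov x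
      refine ⟨x - c, ?_, by rwa [← hammingDist_eq_hammingNorm_sub]⟩
      simpa using hc
    · have hmem : x₀ - x ∈ C := by
        rw [← Submodule.Quotient.eq]
        exact hx.symm
      simpa [hammingDist_eq_hammingNorm_sub] using hx₀ _ hmem

/-- A sum of `s.card` scaled columns is a combination of at most `s.card` columns. -/
lemma exists_linearCombination_eq_sum (h : ι → V) {σ : Type*} (s : Finset σ) (f : σ → ι)
    (t : σ → F) : ∃ x : ι → F,
      Fintype.linearCombination F h x = ∑ k ∈ s, t k • h (f k) ∧ hammingNorm x ≤ s.card := by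
  classical
  refine ⟨∑ k ∈ s, Pi.single (f k) (t k), ?_, ?_⟩
  · simp [map_sum, Fintype.linearCombination_apply_single]
  · refine (Finset.card_le_card (t := s.image f) fun i hi => ?_).trans Finset.card_image_le
    simp only [Finset.mem_filter, Finset.mem_univ, true_and, Finset.sum_apply] at hi
    obtain ⟨k, hk, hne⟩ := Finset.exists_ne_zero_of_sum_ne_zero hi
    refine Finset.mem_image.2 ⟨k, hk, ?_⟩
    by_contra hki
    exact hne (Pi.single_eq_of_ne (Ne.symm hki) _)

end Syndromes

section Vandermonde

variable {K : Type*} [Field K]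

/-- The point `(1, b, …, b ^ (R - 1))` of the normal rational curve, with `none` standing for
the point at infinity `(0, …, 0, 1)`. -/
def rationalCurve (R : ℕ) (b : Option K) (i : Fin R) : K :=
  b.elim 1 id ^ i.1 * b.elim 0 (fun _ => 1) ^ i.rev.1

lemma linearIndependent_rationalCurve {R : ℕ} {β : Fin R → Option K}
    (hβ : Function.Injective β) : LinearIndependent K fun j => rationalCurve R (β j) := by
  refine Matrix.linearIndependent_rows_of_det_ne_zero (A := Matrix.projVandermonde
    (fun j => (β j).elim 1 id) fun j => (β j).elim 0 fun _ => 1) ?_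
  rw [Matrix.det_projVandermonde]
  refine Finset.prod_ne_zero_iff.2 fun i _ => Finset.prod_ne_zero_iff.2 fun j hj => ?_
  have hij : β i ≠ β j := hβ.ne (Finset.mem_Ioi.1 hj).ne
  rcases hi : β i with _ | a <;> rcases hj : β j with _ | b
  · exact absurd (hi.trans hj.symm) hij
  · simp
  · simp
  · have : b ≠ a := by
      rintro rfl
      exact hij (hi.trans hj.symm)
    simpa [sub_eq_zero] using this

lemma linearIndepOn_rationalCurve {ι : Type*} [Fintype ι] {R : ℕ} {β : ι → Option K}
    (hβ : Function.Injective β) (hR : R ≤ Fintype.card ι) {A : Finset ι} (hA : A.card ≤ R) :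
    LinearIndepOn K (fun j => rationalCurve R (β j)) (A : Set ι) := by
  obtain ⟨T, hAT, hT⟩ := Finset.exists_superset_card_eq hA hR
  refine LinearIndepOn.mono ?_ (Finset.coe_subset.2 hAT)
  have e : Fin R ≃ T := (Fintype.equivFinOfCardEq (by simpa using hT)).symm
  rw [LinearIndepOn, ← linearIndependent_equiv e]
  exact linearIndependent_rationalCurve (hβ.comp (Subtype.val_injective.comp e.injective))

/-- At most `R` points of the normal rational curve are completed to a basis of `K ^ R` by
coordinate vectors. -/
lemma exists_completion_rationalCurve {ι : Type*} [Fintype ι] {R : ℕ} {β : ι → Option K}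
    (hβ : Function.Injective β) (hR : R ≤ Fintype.card ι) {A : Finset ι} (hA : A.card ≤ R) :
    ∃ I : Finset (Fin R), A.card + I.card ≤ R ∧ ∀ b : Fin R → K, ∃ (η : ι → K) (ζ : Fin R → K),
      ∑ j ∈ A, η j • rationalCurve R (β j) + ∑ i ∈ I, Pi.single i (ζ i) = b := by
  classical
  let v : ι ⊕ Fin R → Fin R → K :=
    Sum.elim (fun j => rationalCurve R (β j)) fun i => Pi.single i 1
  have hs : LinearIndepOn K v (Sum.inl '' (A : Set ι)) :=
    LinearIndepOn.image_of_comp Sum.inl v (linearIndepOn_rationalCurve hβ hR hA)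
  obtain ⟨B, hBt, hsB, hspan, hB⟩ := exists_linearIndepOn_extension hs
    (t := Sum.inl '' (A : Set ι) ∪ Set.range Sum.inr) Set.subset_union_left
  obtain ⟨B, rfl⟩ := B.toFinite.exists_finset_coe
  have hleft : B.toLeft = A := by
    ext j
    rw [Finset.mem_toLeft]
    refine ⟨fun hj => by simpa using hBt hj, fun hj => hsB ⟨j, hj, rfl⟩⟩
  have hcard : B.card ≤ R := by
    have := LinearIndependent.fintype_card_le_finrank hB
    simpa using this
  rw [← B.toLeft_disjSum_toRight, hleft] at hspan hcard
  refine ⟨B.toRight, by simpa using hcard, fun b => ?_⟩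
  have htop : Submodule.span K (v '' (A.disjSum B.toRight : Finset _)) = ⊤ := by
    rw [eq_top_iff, ← (Pi.basisFun K (Fin R)).span_eq, Submodule.span_le]
    rintro _ ⟨i, rfl⟩
    exact hspan ⟨Sum.inr i, Or.inr ⟨i, rfl⟩, by simp [v]⟩
  have hb : b ∈ Submodule.span K (v '' (A.disjSum B.toRight : Finset _)) := htop ▸ trivial
  obtain ⟨c, hc⟩ := (Submodule.mem_span_image_finset_iff_exists_fun' K).1 hb
  refine ⟨c ∘ Sum.inl, c ∘ Sum.inr, ?_⟩
  rw [← hc, Finset.sum_disjSum]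
  simp [v, ← Pi.single_smul]

end Vandermonde

section Concatenation

variable {F : Type*} [Field F] {K : Type*} [Field K] [Algebra F K]
  {ι V : Type*} [AddCommGroup V] [Module F V]

/-- The columns of the `q ^ m`-concatenating construction: each column `h j` is repeated with
every `K`-multiple of a point of the normal rational curve attached to it, and every coordinate
of `K ^ R` receives a copy of the projective space of `K` over `F`. -/
def concatColumns (R : ℕ) (β : ι → Option K) (h : ι → V) :
    (ι × K) ⊕ (Fin R × Projectivization F K) → V × (Fin R → K) :=
  Sum.elim (fun p => (h p.1, p.2 • rationalCurve R (β p.1)))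
    fun p => (0, Pi.single p.1 p.2.rep)

lemma exists_smul_rep_eq (z : K) : ∃ (P : Projectivization F K) (t : F), t • P.rep = z := by
  by_cases hz : z = 0
  · exact ⟨Projectivization.mk F 1 one_ne_zero, 0, by simp [hz]⟩
  · obtain ⟨a, ha⟩ := Projectivization.exists_smul_eq_mk_rep F z hz
    refine ⟨Projectivization.mk F z hz, (a⁻¹ : Fˣ), ?_⟩
    rw [← ha, ← Units.smul_def, inv_smul_smul]

variable [DecidableEq F] [Fintype ι] [Fintype K] [Fintype (Projectivization F K)]

lemma concatColumns_covers {R : ℕ} {β : ι → Option K} (hβ : Function.Injective β)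
    (hR : R ≤ Fintype.card ι) {h : ι → V} {v : V}
    (hv : ∃ x : ι → F, Fintype.linearCombination F h x = v ∧ hammingNorm x ≤ R)
    (b : Fin R → K) :
    ∃ x, Fintype.linearCombination F (concatColumns (F := F) R β h) x = (v, b) ∧ hammingNorm x ≤ R := by
  classical
  obtain ⟨x, rfl, hx⟩ := hv
  let A : Finset ι := {j | x j ≠ 0}
  obtain ⟨I, hI, hsolve⟩ := exists_completion_rationalCurve hβ hR (A := A) hx
  obtain ⟨η, ζ, hηζ⟩ := hsolve b
  choose P t hPt using fun i => exists_smul_rep_eq (F := F) (ζ i)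
  obtain ⟨y, hy, hyR⟩ := exists_linearCombination_eq_sum (F := F) (concatColumns R β h)
    (A.disjSum I)
    (Sum.elim (fun j => Sum.inl (j, (x j)⁻¹ • η j)) fun i => Sum.inr (i, P i)) (Sum.elim x t)
  refine ⟨y, ?_, hyR.trans (by simpa using hI)⟩
  rw [hy, Finset.sum_disjSum]
  have hA : ∀ j ∈ A, x j ≠ 0 := fun j hj => by simpa [A] using hj
  ext1
  · simp only [concatColumns, Sum.elim_inl, Sum.elim_inr, Prod.smul_mk, smul_zero, Prod.fst_add,
      Prod.fst_sum, Finset.sum_const_zero, add_zero, Fintype.linearCombination_apply]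
    refine Finset.sum_subset (Finset.subset_univ _) fun j _ hj => ?_
    have : x j = 0 := by simpa [A] using hj
    simp [this]
  · simp only [concatColumns, Sum.elim_inl, Sum.elim_inr, Prod.smul_mk, Prod.snd_add,
      Prod.snd_sum, ← hηζ]
    congr 1
    · refine Finset.sum_congr rfl fun j hj => ?_
      rw [smul_assoc, smul_inv_smul₀ (hA j hj)]
    · refine Finset.sum_congr rfl fun i _ => ?_
      rw [← Pi.single_smul, hPt]

lemma concatColumns_needs {R S : ℕ} {β : ι → Option K} {h : ι → V} {v : V}
    (hv : ∀ x : ι → F, Fintype.linearCombination F h x = v → S ≤ hammingNorm x)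
    {b : Fin R → K} {x : (ι × K) ⊕ (Fin R × Projectivization F K) → F}
    (hx : Fintype.linearCombination F (concatColumns R β h) x = (v, b)) :
    S ≤ hammingNorm x := by
  classical
  refine (hv (fun j => ∑ ξ, x (Sum.inl (j, ξ))) ?_).trans ?_
  · have := congrArg Prod.fst hx
    simpa [Fintype.linearCombination_apply, concatColumns, Fintype.sum_prod_type, Prod.fst_sum,
      Finset.sum_smul] using this
  · choose! ξ hξ using fun (j : ι) (hj : ∑ ξ, x (Sum.inl (j, ξ)) ≠ 0) =>
      Finset.exists_ne_zero_of_sum_ne_zero hj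
    refine Finset.card_le_card_of_injOn (fun j => Sum.inl (j, ξ j)) (fun j hj => ?_)
      fun i _ j _ hij => ?_
    · simpa using (hξ j (by simpa using hj)).2
    · simpa using congrArg (Sum.elim Prod.fst fun _ => i) hij

lemma HasSyndromeRadius.concat {R : ℕ} {β : ι → Option K} (hβ : Function.Injective β)
    {h : ι → V} (hh : HasSyndromeRadius F h R) :
    HasSyndromeRadius F (concatColumns (F := F) R β h) R := by
  obtain ⟨hcov, v, hv⟩ := hh
  have hR : R ≤ Fintype.card ι := by
    obtain ⟨x, hx, -⟩ := hcov v
    exact (hv x hx).trans hammingNorm_le_card_fintype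
  exact ⟨fun w => concatColumns_covers hβ hR (hcov w.1) w.2, (v, 0),
    fun x hx => concatColumns_needs hv hx⟩

end Concatenation

lemma FiniteField.exists_extension (F : Type*) [Field F] [Fintype F] {m : ℕ} (hm : 1 ≤ m) :
    ∃ (K : Type) (_ : Field K) (_ : Fintype K) (_ : Algebra F K),
      Module.finrank F K = m ∧ Fintype.card K = Fintype.card F ^ m := by
  obtain ⟨p, _⟩ := CharP.exists F
  have : Fact p.Prime := ⟨CharP.char_is_prime F p⟩
  have : NeZero m := ⟨by omega⟩
  have : Fintype (FiniteField.Extension F p m) := Fintype.ofFinite _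
  refine ⟨FiniteField.Extension F p m, inferInstance, this, inferInstance,
    FiniteField.finrank_extension F p m, ?_⟩
  rw [← Nat.card_eq_fintype_card, FiniteField.natCard_extension, Nat.card_eq_fintype_card]

lemma ExistsCovCode.concat {F : Type*} [Field F] [Fintype F] [DecidableEq F] {n r R m : ℕ}
    (hm : 1 ≤ m) (hex : ExistsCovCode F n r R) (hn : n ≤ Fintype.card F ^ m + 1) :
    ExistsCovCode F
      (Fintype.card F ^ m * n + R * ((Fintype.card F ^ m - 1) / (Fintype.card F - 1)))
      (r + R * m) R := by
  obtain ⟨C, h, hr, hh⟩ := exists_hasSyndromeRadius hex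
  obtain ⟨K, _, _, _, hKm, hK⟩ := FiniteField.exists_extension F hm
  obtain ⟨β⟩ : Nonempty (Fin n ↪ Option K) :=
    Function.Embedding.nonempty_of_card_le (by simpa [hK] using hn)
  have : Fintype (Projectivization F K) := Fintype.ofFinite _
  have : Module.Finite F K := Module.Finite.of_finite
  convert (hh.concat β.injective).existsCovCode using 1
  · simp only [Fintype.card_sum, Fintype.card_prod, Fintype.card_fin, hK]
    rw [← Nat.card_eq_fintype_card (α := Projectivization F K), Projectivization.card'',
      Nat.card_eq_fintype_card, Nat.card_eq_fintype_card, hK, mul_comm n]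
  · rw [Module.finrank_prod, hr, Module.finrank_pi_fintype]
    simp [hKm]

/-- Corollary of Theorem 1, first case. If `q^m + 1 ≥ ℓ_q(r₀,R)` then
`ℓ_q(r₀ + Rm, R) ≤ q^m ℓ_q(r₀,R) + R(q^m - 1)/(q - 1)`, where the length function
`ℓ_q(r,R)` is the smallest length of a `q`-ary linear code of codimension `r` and
covering radius `R`. -/
theorem statement13 (q : ℕ) (F : Type*) [Field F] [Fintype F] [DecidableEq F]
    (hq : Fintype.card F = q) (R m r₀ : ℕ) (hR : 2 ≤ R) (hm : 1 ≤ m)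
    (hex : ∃ n₀, ExistsCovCode F n₀ r₀ R)
    (hbound : sInf {n | ExistsCovCode F n r₀ R} ≤ q ^ m + 1) :
    sInf {n | ExistsCovCode F n (r₀ + R * m) R} ≤
      q ^ m * sInf {n | ExistsCovCode F n r₀ R} + R * ((q ^ m - 1) / (q - 1)) := by
  subst hq
  exact Nat.sInf_le (ExistsCovCode.concat hm (Nat.sInf_mem hex) hbound)
end
end

section
/- Let s be a prime power and let q = s^4. Then for every odd integer r ≥ 3 there exists a linear [n, n−r]_q code with covering radius 2, where n = 2s^{2r−4} + 2s^{2r−5} + 2s^{2r−6} + ⌊s^{2r−10}⌋ (the last term equals 0 for r = 3 and equals s^{2r−10} for r ≥ 5); that is, n = (2 + 2/q^{1/4} + 2/q^{1/2})·q^{(r−2)/2} + ⌊q^{(r−5)/2}⌋. -/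
noncomputable section

/-- A finite family of vectors such that every vector is a combination of two of its members
yields a code of covering radius two, provided that it is too small to cover with multiples. -/
theorem existsCovCode_two_of_columns {L V J : Type*} [Field L] [Fintype L] [DecidableEq L]
    [AddCommGroup V] [Module L V] [FiniteDimensional L V] [Fintype J] {n r : ℕ}
    (hr : Module.finrank L V = r) (hJ : Fintype.card J ≤ n)
    (hn : n * Fintype.card L < Fintype.card L ^ r) (hn0 : 0 < n) (col : J → V)
    (hcol : ∀ v : V, ∃ i j : J, ∃ a b : L, v = a • col i + b • col j) :
    ExistsCovCode L n r 2 := by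
  classical
  obtain ⟨e⟩ : Nonempty (J ↪ Fin n) :=
    Function.Embedding.nonempty_of_card_le (by simpa using hJ)
  set h : Fin n → V := Function.extend e col 0
  have he (j : J) : h (e j) = col j := e.injective.extend_apply _ _ _
  set Φ : (Fin n → L) →ₗ[L] V := Fintype.linearCombination L h with hΦ
  have hΦs (i : Fin n) (a : L) : Φ (Pi.single i a) = a • h i := by
    simp [hΦ, Fintype.linearCombination_apply, Pi.single_apply, ite_smul]
  have hdist (x y : Fin n → L) : hammingDist x y = hammingNorm (x - y) := by
    simp [hammingDist, hammingNorm, sub_ne_zero]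
  have hlift (v : V) : ∃ y : Fin n → L, Φ y = v ∧ hammingNorm y ≤ 2 := by
    obtain ⟨i, j, a, b, rfl⟩ := hcol v
    refine ⟨Pi.single (e i) a + Pi.single (e j) b, by simp [map_add, hΦs, he], ?_⟩
    refine (Finset.card_le_card (t := {e i, e j}) fun k hk => ?_).trans Finset.card_le_two
    simp only [Finset.mem_filter, Finset.mem_univ, true_and, Pi.add_apply] at hk
    by_contra hne
    simp only [Finset.mem_insert, Finset.mem_singleton, not_or] at hne
    simp [hne.1, hne.2] at hk
  have hsurj : Function.Surjective Φ := fun v => (hlift v).imp fun _ hy => hy.1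
  have hrank := Φ.finrank_range_add_finrank_ker
  rw [LinearMap.range_eq_top.2 hsurj, finrank_top, hr, Module.finrank_fin_fun] at hrank
  refine ⟨by omega, LinearMap.ker Φ, by omega, fun x => ?_, ?_⟩
  · obtain ⟨y, hy, hw⟩ := hlift (Φ x)
    refine ⟨x - y, by simp [hy], ?_⟩
    rw [hdist]
    simpa using hw
  · have hcard : ¬ Function.Surjective fun t : Fin n × L => t.2 • h t.1 := by
      intro hs
      have hV : Finite V := Module.finite_of_finite L
      have := Nat.card_le_card_of_surjective _ hs
      rw [Module.natCard_eq_pow_finrank (K := L) (V := V), hr] at this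
      simp only [Nat.card_eq_fintype_card, Fintype.card_prod, Fintype.card_fin] at this
      omega
    simp only [Function.Surjective, not_forall, not_exists] at hcard
    obtain ⟨v, hv⟩ := hcard
    obtain ⟨x, rfl⟩ := hsurj v
    refine ⟨x, fun c hc => ?_⟩
    by_contra! hlt
    rw [hdist] at hlt
    have hc' : Φ (x - c) = Φ x := by rw [map_sub, LinearMap.mem_ker.1 hc, sub_zero]
    obtain ⟨i, hi⟩ : ∃ i : Fin n, ∀ k, k ≠ i → (x - c) k = 0 := by
      have h1 : hammingNorm (x - c) ≤ 1 := by omega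
      have : Nonempty (Fin n) := ⟨⟨0, hn0⟩⟩
      obtain ⟨i, hi⟩ := Finset.card_le_one_iff_subset_singleton.1 h1
      refine ⟨i, fun k hk => ?_⟩
      by_contra hne
      exact hk (Finset.mem_singleton.1 (hi (by simpa using hne)))
    have hsing : x - c = Pi.single i ((x - c) i) := by
      ext k
      by_cases hk : k = i
      · subst hk; simp
      · simp [hk, hi k hk]
    apply hv (i, (x - c) i)
    simp only
    rw [← hΦs, ← hsing, hc']

theorem LinearMap.exists_ne_zero_map_eq_zero {F V W : Type*} [Field F] [AddCommGroup V]
    [Module F V] [AddCommGroup W] [Module F W] [FiniteDimensional F V] [FiniteDimensional F W]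
    (f : V →ₗ[F] W) (h : Module.finrank F W < Module.finrank F V) : ∃ v ≠ 0, f v = 0 := by
  obtain ⟨v, hv, hv0⟩ := (Submodule.ne_bot_iff _).1 (f.ker_ne_bot_of_finrank_lt h)
  exact ⟨v, hv0, hv⟩

/-- Two independent vectors in a plane of a three-dimensional space span that plane. -/
theorem exists_eq_smul_add_smul_of_dotProduct_eq_zero {L : Type*} [Field L] {f u a b : Fin 3 → L}
    (hf : f ≠ 0) (hu : u ⬝ᵥ f = 0) (ha : a ⬝ᵥ f = 0) (hb : b ⬝ᵥ f = 0)
    (hab : LinearIndependent L ![a, b]) : ∃ α β : L, u = α • a + β • b := by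
  have key (v : Fin 3 → L) : Fintype.linearCombination L f v = v ⬝ᵥ f := by
    simp [Fintype.linearCombination_apply, dotProduct]
  have hle : Submodule.span L {a, b} ≤ LinearMap.ker (Fintype.linearCombination L f) := by
    rw [Submodule.span_le]
    rintro v (rfl | rfl) <;> simpa [key]
  have hspan : Module.finrank L (Submodule.span L {a, b}) = 2 := by
    rw [← Matrix.range_cons_cons_empty a b ![], finrank_span_eq_card hab, Fintype.card_fin]
  have hrank := (Fintype.linearCombination L f).finrank_range_add_finrank_ker
  have hpos : 0 < Module.finrank L (LinearMap.range (Fintype.linearCombination L f)) := by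
    rw [Module.finrank_pos_iff, Submodule.nontrivial_iff_ne_bot, Ne, LinearMap.range_eq_bot]
    intro h0
    apply hf
    ext i
    simpa [key] using LinearMap.congr_fun h0 (Pi.single i 1)
  rw [Module.finrank_fin_fun] at hrank
  have hmem : u ∈ Submodule.span L {a, b} := by
    rw [Submodule.eq_of_le_of_finrank_le hle (by omega)]
    simpa [key] using hu
  obtain ⟨α, β, h⟩ := Submodule.mem_span_pair.1 hmem
  exact ⟨α, β, h.symm⟩

section Subplanes

variable {F K L : Type*} [Field F] [Field K] [Field L] [Algebra F K] [Algebra K L]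

theorem linearIndependent_pair_algebraMap_comp {ι : Type*} {a b : ι → K}
    (h : LinearIndependent K ![a, b]) :
    LinearIndependent L ![algebraMap K L ∘ a, algebraMap K L ∘ b] := by
  have ha : a ≠ 0 := h.ne_zero 0
  rw [LinearIndependent.pair_iff' ha] at h
  obtain ⟨i, hi⟩ := Function.ne_iff.1 ha
  have hi' : algebraMap K L (a i) ≠ 0 := by simpa using hi
  rw [LinearIndependent.pair_iff' (fun h0 => hi' (congrFun h0 i))]
  intro c hc
  apply h (b i / a i)
  have hci : c * algebraMap K L (a i) = algebraMap K L (b i) := congrFun hc i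
  have hc' : c = algebraMap K L (b i / a i) := by
    rw [map_div₀, ← hci]; field_simp
  ext j
  have hcj : c * algebraMap K L (a j) = algebraMap K L (b j) := congrFun hc j
  apply (algebraMap K L).injective
  simp [← hcj, hc']

/-- A subplane over a subfield of index two meets every line. -/
theorem exists_ne_zero_subplane_dotProduct_eq_zero (hFK : Module.finrank F K = 2)
    (A : (Fin 3 → F) →ₗ[F] (Fin 3 → K)) (f : Fin 3 → K) : ∃ x ≠ 0, A x ⬝ᵥ f = 0 := by
  have : FiniteDimensional F K := Module.finite_of_finrank_pos (by omega)
  obtain ⟨x, hx, h⟩ := LinearMap.exists_ne_zero_map_eq_zero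
    ((Fintype.linearCombination K f).restrictScalars F ∘ₗ A) (by simp [hFK])
  exact ⟨x, hx, by simpa [Fintype.linearCombination_apply, dotProduct] using h⟩

/-- Given two disjoint subplanes, each point of the first one lies on a line joining another point
of the first one to a point of the second one. -/
theorem exists_eq_smul_add_smul_of_mem_subplane (hFK : Module.finrank F K = 2)
    (A B : (Fin 3 → F) →ₗ[F] (Fin 3 → K))
    (hAB : ∀ x ≠ 0, ∀ y ≠ 0, LinearIndependent K ![A x, B y]) {e : Fin 3 → F} (he : e ≠ 0) :
    ∃ x ≠ 0, ∃ y ≠ 0, ∃ α β : K, α ≠ 0 ∧ β ≠ 0 ∧ A e = α • A x + β • B y := by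
  have hA (x : Fin 3 → F) (hx : x ≠ 0) : A x ≠ 0 := (hAB x hx x hx).ne_zero 0
  obtain ⟨i, hi⟩ := Function.ne_iff.1 (hA e he)
  obtain ⟨x, hx, hxi⟩ := exists_ne_zero_subplane_dotProduct_eq_zero hFK A (Pi.single i 1)
  simp only [dotProduct_single, mul_one] at hxi
  have hex (k : K) : k • A e ≠ A x := by
    intro hk
    have hki : k * A e i = A x i := congrFun hk i
    rw [hxi, mul_eq_zero, or_iff_left (by simpa using hi)] at hki
    exact hA x hx (by rw [← hk, hki, zero_smul])
  obtain ⟨f, hf, hf0⟩ := LinearMap.exists_ne_zero_map_eq_zero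
    ((Fintype.linearCombination K (A e)).prod (Fintype.linearCombination K (A x))) (by simp)
  replace hf0 := Prod.mk_eq_zero.1 hf0
  have key (v : Fin 3 → K) : Fintype.linearCombination K v f = v ⬝ᵥ f := by
    simp [Fintype.linearCombination_apply, dotProduct, mul_comm]
  rw [key, key] at hf0
  obtain ⟨y, hy, hyf⟩ := exists_ne_zero_subplane_dotProduct_eq_zero hFK B f
  obtain ⟨α, β, h⟩ :=
    exists_eq_smul_add_smul_of_dotProduct_eq_zero hf hf0.1 hf0.2 hyf (hAB x hx y hy)
  refine ⟨x, hx, y, hy, α, β, ?_, ?_, h⟩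
  · rintro rfl
    have := LinearIndependent.pair_symm_iff.1 (hAB e he y hy)
    have hBy : B y ≠ 0 := this.ne_zero 0
    rw [LinearIndependent.pair_iff' hBy] at this
    exact this β (by simp [h])
  · rintro rfl
    simp only [zero_smul, add_zero] at h
    have hα : α ≠ 0 := by
      rintro rfl
      exact hA e he (by simp [h])
    exact hex α⁻¹ (by rw [h, smul_smul, inv_mul_cancel₀ hα, one_smul])

/-- Given two disjoint subplanes over the subfield of index four, every point of the plane lies on
a line joining two other points, one in each subplane. -/
theorem exists_eq_smul_add_smul_of_subplanes (hFK : Module.finrank F K = 2)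
    (hKL : Module.finrank K L = 2) (A B : (Fin 3 → F) →ₗ[F] (Fin 3 → K))
    (hAB : ∀ x ≠ 0, ∀ y ≠ 0, LinearIndependent K ![A x, B y]) {u : Fin 3 → L} (hu : u ≠ 0) :
    ∃ x ≠ 0, ∃ y ≠ 0, ∃ α β : L, α ≠ 0 ∧ β ≠ 0 ∧
      u = α • (algebraMap K L ∘ A x) + β • (algebraMap K L ∘ B y) := by
  have hcomp (c d : K) (v w : Fin 3 → K) : algebraMap K L ∘ (c • v + d • w) =
      algebraMap K L c • (algebraMap K L ∘ v) + algebraMap K L d • (algebraMap K L ∘ w) := by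
    ext; simp [-algebraMap_smul]
  have : FiniteDimensional K L := Module.finite_of_finrank_pos (by omega)
  obtain ⟨f, hf, hf0⟩ := LinearMap.exists_ne_zero_map_eq_zero
    (Fintype.linearCombination K u) (by simp [hKL])
  have hfL : algebraMap K L ∘ f ≠ 0 := by
    obtain ⟨i, hi⟩ := Function.ne_iff.1 hf
    exact fun h => hi (by simpa using congrFun h i)
  have huf : u ⬝ᵥ (algebraMap K L ∘ f) = 0 := by
    simpa [Fintype.linearCombination_apply, dotProduct, Algebra.smul_def, mul_comm] using hf0
  have hmap (v : Fin 3 → K) (hv : v ⬝ᵥ f = 0) :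
      (algebraMap K L ∘ v) ⬝ᵥ (algebraMap K L ∘ f) = 0 := by
    rw [← RingHom.map_dotProduct, hv, map_zero]
  obtain ⟨x, hx, hxf⟩ := exists_ne_zero_subplane_dotProduct_eq_zero hFK A f
  obtain ⟨y, hy, hyf⟩ := exists_ne_zero_subplane_dotProduct_eq_zero hFK B f
  obtain ⟨α, β, h⟩ := exists_eq_smul_add_smul_of_dotProduct_eq_zero hfL huf (hmap _ hxf)
    (hmap _ hyf) (linearIndependent_pair_algebraMap_comp (hAB x hx y hy))
  by_cases hα : α = 0
  · have hβ : β ≠ 0 := by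
      rintro rfl
      exact hu (by simp [h, hα])
    obtain ⟨y', hy', x', hx', c, d, hc, hd, hcd⟩ := exists_eq_smul_add_smul_of_mem_subplane hFK B A
      (fun y hy x hx => LinearIndependent.pair_symm_iff.1 (hAB x hx y hy)) hy
    refine ⟨x', hx', y', hy', β * algebraMap K L d, β * algebraMap K L c, by simp [hβ, hd],
      by simp [hβ, hc], ?_⟩
    rw [h, hα, hcd, hcomp]
    module
  by_cases hβ : β = 0
  · obtain ⟨x', hx', y', hy', c, d, hc, hd, hcd⟩ :=
      exists_eq_smul_add_smul_of_mem_subplane hFK A B hAB hx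
    refine ⟨x', hx', y', hy', α * algebraMap K L c, α * algebraMap K L d, by simp [hα, hc],
      by simp [hα, hd], ?_⟩
    rw [h, hβ, hcd, hcomp]
    module
  · exact ⟨x, hx, y, hy, α, β, hα, hβ, h⟩

/-- A finite field has a cubic `t³ - t - c` without roots; its companion matrix has no
eigenvectors. -/
theorem exists_linearMap_ne_smul (F : Type*) [Field F] [Finite F] :
    ∃ T : (Fin 3 → F) →ₗ[F] (Fin 3 → F), ∀ x ≠ 0, ∀ k : F, T x ≠ k • x := by
  obtain ⟨c, hc⟩ : ∃ c : F, ∀ t : F, t ^ 3 - t ≠ c := by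
    have hns : ¬ Function.Surjective fun t : F => t ^ 3 - t := by
      rw [← Finite.injective_iff_surjective]
      intro hinj
      exact zero_ne_one (hinj (a₁ := 0) (a₂ := 1) (by simp))
    simpa [Function.Surjective] using hns
  refine ⟨Matrix.toLin' !![0, 0, c; 1, 0, 1; 0, 1, 0], fun x hx k h => hx ?_⟩
  have h0 := congrFun h 0
  have h1 := congrFun h 1
  have h2 := congrFun h 2
  simp [Matrix.mulVec, dotProduct, Fin.sum_univ_three] at h0 h1 h2
  have hx2 : x 2 = 0 := by
    by_contra hne
    apply hc k
    apply mul_right_cancel₀ hne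
    linear_combination -h0 - k * h1 - k ^ 2 * h2 + k * h2 * k - k * h2 * k
  have hx1 : x 1 = 0 := by rw [h2, hx2, mul_zero]
  have hx0 : x 0 = 0 := by simpa [hx1, hx2] using h1
  ext i
  fin_cases i <;> simpa

/-- Disjoint Baer subplanes exist. -/
theorem exists_disjoint_subplanes [Finite F] (hFK : Module.finrank F K = 2) :
    ∃ A B : (Fin 3 → F) →ₗ[F] (Fin 3 → K),
      ∀ x ≠ 0, ∀ y ≠ 0, LinearIndependent K ![A x, B y] := by
  obtain ⟨T, hT⟩ := exists_linearMap_ne_smul F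
  obtain ⟨κ, hκ⟩ : ∃ κ : K, ∀ a : F, algebraMap F K a ≠ κ := by
    by_contra! h
    have := finrank_eq_one_iff_of_nonzero' (1 : K) one_ne_zero |>.2 fun w => by
      obtain ⟨a, ha⟩ := h w
      exact ⟨a, by rw [← ha, Algebra.smul_def, mul_one]⟩
    omega
  have hκ2 (a b : F) (h : algebraMap F K a + κ * algebraMap F K b = 0) : a = 0 ∧ b = 0 := by
    have hb : b = 0 := by
      by_contra hb
      apply hκ (-a / b)
      have hb' : algebraMap F K b ≠ 0 := by simpa using hb
      rw [map_div₀, map_neg, div_eq_iff hb']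
      linear_combination -h
    exact ⟨by simpa [hb] using h, hb⟩
  set ι : (Fin 3 → F) →ₗ[F] (Fin 3 → K) := (Algebra.linearMap F K).compLeft (Fin 3) with hι
  have hι_apply (x : Fin 3 → F) (i : Fin 3) : ι x i = algebraMap F K (x i) := rfl
  refine ⟨ι, ι ∘ₗ T + κ • ι, fun x hx y hy => ?_⟩
  obtain ⟨i, hi⟩ := Function.ne_iff.1 hx
  have hi' : algebraMap F K (x i) ≠ 0 := by simpa using hi
  rw [LinearIndependent.pair_iff' (fun h => hi' (congrFun h i))]
  intro k hk
  have hkj (j : Fin 3) :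
      k * algebraMap F K (x j) = algebraMap F K (T y j) + κ * algebraMap F K (y j) := congrFun hk j
  have hprop (j : Fin 3) : T y i * x j - T y j * x i = 0 ∧ y i * x j - y j * x i = 0 := by
    apply hκ2
    simp only [map_sub, map_mul]
    linear_combination algebraMap F K (x i) * hkj j - algebraMap F K (x j) * hkj i
  have hyi : y i ≠ 0 := by
    intro h0
    apply hy
    ext j
    have := (hprop j).2
    simp only [h0, zero_mul, zero_sub, neg_eq_zero, mul_eq_zero] at this
    exact this.resolve_right hi
  apply hT y hy (T y i / y i)
  ext j
  apply mul_right_cancel₀ hi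
  simp only [Pi.smul_apply, smul_eq_mul]
  field_simp
  linear_combination T y i * (hprop j).2 - y i * (hprop j).1

end Subplanes

/-- On an extension of a suitable finite field there is a function (a square or a cube) whose
graph determines all non-vertical directions. -/
theorem exists_function_directions {L M : Type*} [Field L] [Fintype L] [Field M] [Finite M]
    [Algebra L M] {s : ℕ} (hs : IsPrimePow s) (hL : Fintype.card L = s ^ 4) :
    ∃ φ : M → M, ∀ v ≠ 0, ∀ w, ∃ c : L, c ≠ 0 ∧ ∃ ξ η : M,
      c • (ξ - η) = v ∧ c • (φ ξ - φ η) = w := by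
  by_cases h2 : (2 : M) = 0
  · refine ⟨fun x => x ^ 3, fun v hv w => ?_⟩
    have h2L : (2 : L) = 0 := (algebraMap L M).injective (by rw [map_ofNat, h2, map_zero])
    have : CharP L 2 := CharTwo.of_one_ne_zero_of_two_eq_zero one_ne_zero h2L
    let g : M →+ M := AddMonoidHom.mk' (fun x => x ^ 2 + x) fun a b => by
      linear_combination a * b * h2
    have hg (x : M) : g x = x ^ 2 + x := rfl
    have hidx (a b : M) (ha : a ∉ g.range) (hb : b ∉ g.range) : a + b ∈ g.range := by
      have hker : Nat.card g.ker = 2 := by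
        have : (g.ker : Set M) = {0, 1} := by
          ext x
          have : g x = x * (x - 1) := by rw [hg]; linear_combination x * h2
          simp [AddMonoidHom.mem_ker, this, sub_eq_zero]
        rw [← SetLike.coe_sort_coe, this, Nat.card_coe_set_eq, Set.ncard_pair zero_ne_one]
      have hindex : g.range.index = 2 := by
        have h3 := g.ker.card_mul_index
        have h4 := g.range.card_mul_index
        rw [AddSubgroup.index_ker, hker] at h3
        exact Nat.eq_of_mul_eq_mul_left Nat.card_pos (by rw [h4, ← h3, mul_comm])
      rw [AddSubgroup.add_mem_iff_of_index_two hindex]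
      tauto
    have hω : ∃ ω : L, ω ^ 2 + ω = 1 := by
      obtain ⟨p, k, hp, hk, rfl⟩ := (isPrimePow_nat_iff _).1 hs
      have h2p : 2 ∣ p := by
        have hdvd : 2 ∣ Fintype.card L :=
          (CharP.cast_eq_zero_iff L 2 _).1 (FiniteField.cast_card_eq_zero L)
        rw [hL] at hdvd
        exact Nat.prime_two.dvd_of_dvd_pow (Nat.prime_two.dvd_of_dvd_pow hdvd)
      obtain rfl := (Nat.prime_dvd_prime_iff_eq Nat.prime_two hp).1 h2p
      have h3 : 3 ∣ Nat.card Lˣ := by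
        rw [Nat.card_units, Nat.card_eq_fintype_card, hL, ← pow_mul, mul_comm, pow_mul]
        exact (show 3 ∣ 2 ^ 4 - 1 by norm_num).trans (Nat.sub_one_dvd_pow_sub_one (2 ^ 4) k)
      have : Fact (Nat.Prime 3) := ⟨Nat.prime_three⟩
      obtain ⟨ζ, hζ⟩ := exists_prime_orderOf_dvd_card' 3 h3
      have hζ3 : (ζ : L) ^ 3 = 1 := by
        rw [← Units.val_pow_eq_pow_val, ← hζ, pow_orderOf_eq_one, Units.val_one]
      have hζ1 : (ζ : L) - 1 ≠ 0 := by
        intro h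
        have : ζ = 1 := Units.ext (sub_eq_zero.1 h)
        simp [this] at hζ
      refine ⟨ζ, mul_left_cancel₀ hζ1 ?_⟩
      linear_combination hζ3 + (1 - ζ) * h2L
    obtain ⟨ω, hω⟩ := hω
    set k : M := w / v ^ 3 with hk
    obtain ⟨c, hc, hcr⟩ : ∃ c : L, c ≠ 0 ∧ k * algebraMap L M c ^ 2 ∈ g.range := by
      have hω0 : ω ≠ 0 := by rintro rfl; simp at hω
      have hω1 : ω + 1 ≠ 0 := by
        intro h
        have : ω * (ω + 1) = 1 := by linear_combination hω
        simp [h] at this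
      by_contra! hcon
      apply hcon (ω + 1) hω1
      have := hidx _ _ (hcon ω hω0) (hcon 1 one_ne_zero)
      convert this using 1
      simp only [map_add, map_one]
      linear_combination k * algebraMap L M ω * h2
    obtain ⟨ξ, hξ⟩ := hcr
    rw [hg] at hξ
    have hω' : algebraMap L M ω ^ 2 + algebraMap L M ω = 1 := by
      rw [← map_pow, ← map_add, hω, map_one]
    have hcM : algebraMap L M c ≠ 0 := by simpa using hc
    set t := ξ + algebraMap L M ω
    have ht1 : t ^ 2 + t + 1 = k * algebraMap L M c ^ 2 := by
      linear_combination hξ + hω' + (ξ * algebraMap L M ω + 1) * h2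
    refine ⟨c, hc, v / algebraMap L M c * (t + 1), v / algebraMap L M c * t, ?_, ?_⟩
    · rw [Algebra.smul_def]
      field_simp
      ring
    · have hcube : (t + 1) ^ 3 - t ^ 3 = k * algebraMap L M c ^ 2 := by
        linear_combination ht1 + (t ^ 2 + t) * h2
      simp only
      rw [Algebra.smul_def, mul_pow, mul_pow, ← mul_sub, hcube, hk]
      field_simp
  · refine ⟨fun x => x ^ 2, fun v hv w => ⟨1, one_ne_zero, (w / v + v) / 2, (w / v - v) / 2, ?_⟩⟩
    simp only [one_smul]
    constructor <;> field_simp <;> ring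

theorem exists_function_directions_fin {L : Type*} [Field L] [Fintype L] {s : ℕ}
    (hs : IsPrimePow s) (hL : Fintype.card L = s ^ 4) (m : ℕ) :
    ∃ φ : (Fin m → L) → (Fin m → L), ∀ v ≠ 0, ∀ w, ∃ c : L, c ≠ 0 ∧ ∃ ξ η : Fin m → L,
      c • (ξ - η) = v ∧ c • (φ ξ - φ η) = w := by
  rcases Nat.eq_zero_or_pos m with rfl | hm
  · exact ⟨id, fun v hv => (hv (Subsingleton.elim _ _)).elim⟩
  obtain ⟨p, hp⟩ := CharP.exists L
  have : Fact p.Prime := ⟨CharP.char_is_prime L p⟩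
  have : NeZero m := ⟨hm.ne'⟩
  obtain ⟨φ, hφ⟩ := exists_function_directions (M := FiniteField.Extension L p m) hs hL
  have e : FiniteField.Extension L p m ≃ₗ[L] (Fin m → L) :=
    LinearEquiv.ofFinrankEq _ _ (by
      rw [FiniteField.finrank_extension, Module.finrank_fin_fun])
  refine ⟨fun x => e (φ (e.symm x)), fun v hv w => ?_⟩
  obtain ⟨c, hc, ξ, η, h1, h2⟩ := hφ (e.symm v) (by simpa using hv) (e.symm w)
  refine ⟨c, hc, e ξ, e η, ?_, ?_⟩
  · rw [← map_sub, ← map_smul, h1, e.apply_symm_apply]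
  · simp only [e.symm_apply_apply]
    rw [← map_sub, ← map_smul, h2, e.apply_symm_apply]

/-- A field with `s⁴` elements is the top of a tower of two quadratic extensions. -/
theorem exists_quadratic_tower {s : ℕ} (hs : IsPrimePow s) (L : Type*) [Field L] [Fintype L]
    (hL : Fintype.card L = s ^ 4) :
    ∃ (F K : Type) (_ : Field F) (_ : Field K) (_ : Finite F) (_ : Algebra F K) (_ : Algebra K L),
      Nat.card F = s ∧ Module.finrank F K = 2 ∧ Module.finrank K L = 2 := by
  obtain ⟨p, k, hp, hk, rfl⟩ := (isPrimePow_nat_iff _).1 hs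
  have : Fact p.Prime := ⟨hp⟩
  have hcard : Nat.card L = p ^ (4 * k) := by
    rw [Nat.card_eq_fintype_card, hL, ← pow_mul, mul_comm]
  have hchar : CharP L p :=
    charP_of_card_eq_prime_pow (by rw [← Nat.card_eq_fintype_card, hcard])
  let _ : Algebra (ZMod p) L := ZMod.algebra L p
  have hrL : Module.finrank (ZMod p) L = 4 * k :=
    Nat.pow_right_injective hp.two_le
      ((FiniteField.pow_finrank_eq_natCard p L).trans hcard)
  have hrK : Module.finrank (ZMod p) (GaloisField p (2 * k)) = 2 * k :=
    GaloisField.finrank p (by omega)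
  have hrF : Module.finrank (ZMod p) (GaloisField p k) = k := GaloisField.finrank p hk.ne'
  obtain ⟨f⟩ := FiniteField.nonempty_algHom_of_finrank_dvd (F := ZMod p)
    (K := GaloisField p k) (L := GaloisField p (2 * k)) (by rw [hrF, hrK]; exact dvd_mul_left _ _)
  obtain ⟨g⟩ := FiniteField.nonempty_algHom_of_finrank_dvd (F := ZMod p)
    (K := GaloisField p (2 * k)) (L := L) (by rw [hrK, hrL]; exact ⟨2, by ring⟩)
  let _ : Algebra (GaloisField p k) (GaloisField p (2 * k)) := f.toRingHom.toAlgebra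
  let _ : Algebra (GaloisField p (2 * k)) L := g.toRingHom.toAlgebra
  have : IsScalarTower (ZMod p) (GaloisField p k) (GaloisField p (2 * k)) :=
    .of_algebraMap_eq' (Subsingleton.elim _ _)
  have : IsScalarTower (ZMod p) (GaloisField p (2 * k)) L :=
    .of_algebraMap_eq' (Subsingleton.elim _ _)
  have h1 := Module.finrank_mul_finrank (ZMod p) (GaloisField p k) (GaloisField p (2 * k))
  have h2 := Module.finrank_mul_finrank (ZMod p) (GaloisField p (2 * k)) L
  rw [hrF, hrK] at h1
  rw [hrK, hrL] at h2
  refine ⟨GaloisField p k, GaloisField p (2 * k), inferInstance, inferInstance, inferInstance,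
    inferInstance, inferInstance, GaloisField.card p k hk.ne', ?_, ?_⟩
  · exact Nat.eq_of_mul_eq_mul_left hk (by rw [h1, mul_comm])
  · exact Nat.eq_of_mul_eq_mul_left (show 0 < 2 * k by omega) (by rw [h2]; ring)

/-- The columns of the parity-check matrix: two disjoint subplanes, one lifted by the graph of a
function and the other one by a coordinate subspace. -/
theorem exists_columns.{u} {s : ℕ} (hs : IsPrimePow s) (L : Type u) [Field L] [Fintype L]
    (hL : Fintype.card L = s ^ 4) (m : ℕ) :
    ∃ (J : Type u) (_ : Fintype J) (col : J → (Fin 3 → L) × (Fin m → L) × (Fin m → L)),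
      Fintype.card J = (2 * s ^ 2 + 2 * s + 2) * (s ^ 4) ^ m ∧
      ∀ v, ∃ i j : J, ∃ a b : L, v = a • col i + b • col j := by
  classical
  obtain ⟨F, K, _, _, _, _, _, hF, hFK, hKL⟩ := exists_quadratic_tower hs L hL
  obtain ⟨A, B, hAB⟩ := exists_disjoint_subplanes hFK
  obtain ⟨φ, hφ⟩ := exists_function_directions_fin hs hL m
  let P := Projectivization F (Fin 3 → F)
  have : Fintype P := Fintype.ofFinite _
  have hP : Fintype.card P = s ^ 2 + s + 1 := by
    rw [← Nat.card_eq_fintype_card, Projectivization.card_of_finrank F _ (Module.finrank_fin_fun F),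
      hF]
    simp [Finset.sum_range_succ]
    ring
  have hrep (C : (Fin 3 → F) →ₗ[F] (Fin 3 → K)) (x : Fin 3 → F) (hx : x ≠ 0) :
      ∃ (p : P) (c : L), c ≠ 0 ∧ algebraMap K L ∘ C x = c • (algebraMap K L ∘ C p.rep) := by
    obtain ⟨a, ha⟩ := Projectivization.exists_smul_eq_mk_rep F x hx
    refine ⟨Projectivization.mk F x hx, algebraMap K L (algebraMap F K (a⁻¹ : Fˣ)), by simp, ?_⟩
    rw [← ha, Units.smul_def, map_smul]
    ext i
    simp [Algebra.smul_def (a : F) (C x i)]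
  have p₀ : P := Projectivization.mk F (fun _ => 1) (fun h => one_ne_zero (congrFun h 0))
  refine ⟨(P × (Fin m → L)) ⊕ (P × (Fin m → L)), inferInstance,
    Sum.elim (fun t => (algebraMap K L ∘ A t.1.rep, t.2, φ t.2))
      (fun t => (algebraMap K L ∘ B t.1.rep, 0, t.2)), ?_, ?_⟩
  · simp [hP, hL]
    ring
  · rintro ⟨u, v, w⟩
    by_cases hu : u = 0
    · by_cases hv : v = 0
      · refine ⟨Sum.inr (p₀, w), Sum.inr (p₀, 0), 1, -1, ?_⟩
        ext <;> simp [hu, hv]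
      · obtain ⟨c, -, ξ, η, h1, h2⟩ := hφ v hv w
        refine ⟨Sum.inl (p₀, ξ), Sum.inl (p₀, η), c, -c, ?_⟩
        rw [← h1, ← h2]
        ext <;> simp [hu] <;> ring
    · obtain ⟨x, hx, y, hy, α, β, hα, hβ, h⟩ :=
        exists_eq_smul_add_smul_of_subplanes hFK hKL A B hAB hu
      obtain ⟨p, c, hc, hxp⟩ := hrep A x hx
      obtain ⟨q, d, hd, hyq⟩ := hrep B y hy
      refine ⟨Sum.inl (p, (α * c)⁻¹ • v),
        Sum.inr (q, (β * d)⁻¹ • (w - (α * c) • φ ((α * c)⁻¹ • v))), α * c, β * d, ?_⟩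
      have hαc : α * c ≠ 0 := mul_ne_zero hα hc
      have hβd : β * d ≠ 0 := mul_ne_zero hβ hd
      simp only [Sum.elim_inl, Sum.elim_inr, Prod.smul_mk, Prod.mk_add_mk, smul_smul,
        mul_inv_cancel₀ hαc, mul_inv_cancel₀ hβd, one_smul, smul_zero, add_zero]
      rw [h, hxp, hyq, smul_smul, smul_smul]
      simp

/-- Theorem 17. For `q = s^4` and every odd `r ≥ 3` there is an
`[n, n-r]_q` code of covering radius `2` with
`n = 2s^{2r-4} + 2s^{2r-5} + 2s^{2r-6} + ⌊s^{2r-10}⌋`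
(the last term being `0` for `r = 3`). -/
theorem statement14 (s : ℕ) (hs : IsPrimePow s)
    (L : Type*) [Field L] [Fintype L] [DecidableEq L]
    (hL : Fintype.card L = s ^ 4)
    (r : ℕ) (hr3 : 3 ≤ r) (hodd : Odd r) :
    ExistsCovCode L
      (2 * s ^ (2 * r - 4) + 2 * s ^ (2 * r - 5) + 2 * s ^ (2 * r - 6) +
        (if r = 3 then 0 else s ^ (2 * r - 10))) r 2 := by
  have hs2 : 2 ≤ s := hs.two_le
  obtain ⟨m, rfl⟩ : ∃ m, r = 3 + 2 * m := by
    obtain ⟨k, rfl⟩ := hodd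
    exact ⟨k - 1, by omega⟩
  obtain ⟨J, _, col, hJ, hcol⟩ := exists_columns hs L hL m
  have e1 : 2 * (3 + 2 * m) - 4 = 4 * m + 2 := by omega
  have e2 : 2 * (3 + 2 * m) - 5 = 4 * m + 1 := by omega
  have e3 : 2 * (3 + 2 * m) - 6 = 4 * m := by omega
  rw [e1, e2, e3]
  have hpos : 0 < s ^ (4 * m) := by positivity
  have hsplit : 2 * s ^ (4 * m + 2) + 2 * s ^ (4 * m + 1) + 2 * s ^ (4 * m) =
      (2 * s ^ 2 + 2 * s + 2) * s ^ (4 * m) := by ring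
  rw [hsplit]
  set d := if 3 + 2 * m = 3 then 0 else s ^ (2 * (3 + 2 * m) - 10) with hd
  have hdle : d ≤ s ^ (4 * m) := by
    rw [hd]
    split_ifs
    · omega
    · exact Nat.pow_le_pow_right (by omega) (by omega)
  refine existsCovCode_two_of_columns (J := J) ?_ ?_ ?_ ?_ col hcol
  · simp
    ring
  · rw [hJ, ← pow_mul]
    omega
  · rw [hL]
    have hb : 2 * s ^ 2 + 2 * s + 3 < s ^ 8 := by
      have h4 : 4 ≤ s ^ 2 := by nlinarith
      have h16 : 16 ≤ s ^ 4 := by nlinarith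
      nlinarith
    calc ((2 * s ^ 2 + 2 * s + 2) * s ^ (4 * m) + d) * s ^ 4
        ≤ (2 * s ^ 2 + 2 * s + 3) * (s ^ (4 * m) * s ^ 4) := by nlinarith
      _ ≤ (2 * s ^ 2 + 2 * s + 3) * (s ^ (8 * m) * s ^ 4) := by
          gcongr <;> omega
      _ < s ^ 8 * (s ^ (8 * m) * s ^ 4) := by gcongr
      _ = (s ^ 4) ^ (3 + 2 * m) := by ring
  · positivity
end
end

section
/- Let q' ≥ 4 be a prime power and let q = (q')^3 (so q ≥ 64). Then for every integer r ≥ 7 with r ≡ 1 (mod 3) there exists a linear [n, n−r]_q code with covering radius 3, where n = 4(q')^{r−3} + 4(q')^{r−4}; that is, n = (4 + 4/q^{1/3})·q^{(r−3)/3}. -/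
noncomputable section

/-- A family of `n` columns spanning an `r`-dimensional space with at most `R` columns per vector,
`R` being necessary for some vector, is a parity check matrix of a code of covering radius `R`. -/
theorem existsCovCode_of_columns {F V : Type*} [Field F] [DecidableEq F] [AddCommGroup V]
    [Module F V] [FiniteDimensional F V] {n r R : ℕ} (hV : Module.finrank F V = r) (h : Fin n → V)
    (hcov : ∀ v, ∃ (i : Fin R → Fin n) (c : Fin R → F), ∑ t, c t • h (i t) = v)
    (hlow : ∃ v, ∀ c : Fin n → F, ∑ i, c i • h i = v → R ≤ hammingNorm c) :
    ExistsCovCode F n r R := by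
  have key : ∀ v, ∃ e : Fin n → F, Fintype.linearCombination F h e = v ∧ hammingNorm e ≤ R := by
    intro v
    obtain ⟨i, c, rfl⟩ := hcov v
    obtain ⟨e, he⟩ : ∃ e : Fin n → F, e = ∑ t, Pi.single (i t) (c t) := ⟨_, rfl⟩
    refine ⟨e, ?_, ?_⟩
    · simp only [he, map_sum, Fintype.linearCombination_apply_single]
    · have hsub : (Finset.univ.filter fun j => e j ≠ 0) ⊆ Finset.univ.image i := by
        intro j hj
        by_contra hne
        simp only [Finset.mem_image, Finset.mem_univ, true_and, not_exists] at hne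
        refine (Finset.mem_filter.1 hj).2 ?_
        rw [he, Finset.sum_apply]
        exact Finset.sum_eq_zero fun t _ => Pi.single_eq_of_ne (Ne.symm (hne t)) _
      exact (Finset.card_le_card hsub).trans (Finset.card_image_le.trans (by simp))
  have hsurj : LinearMap.range (Fintype.linearCombination F h) = ⊤ :=
    LinearMap.range_eq_top.2 fun v => (key v).imp fun _ => And.left
  have hdim := LinearMap.finrank_range_add_finrank_ker (Fintype.linearCombination F h)
  rw [hsurj, finrank_top, hV, Module.finrank_fin_fun] at hdim
  refine ⟨by omega, LinearMap.ker (Fintype.linearCombination F h), by omega, fun x => ?_, ?_⟩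
  · obtain ⟨e, he, hw⟩ := key (Fintype.linearCombination F h x)
    refine ⟨x - e, by simp [he], ?_⟩
    rwa [hammingDist_comm, hammingDist_eq_hammingNorm, neg_add_eq_sub, sub_sub_cancel]
  · obtain ⟨v, hv⟩ := hlow
    obtain ⟨x, hx, -⟩ := key v
    refine ⟨x, fun c hc => ?_⟩
    rw [hammingDist_comm, hammingDist_eq_hammingNorm, neg_add_eq_sub]
    apply hv
    rw [← Fintype.linearCombination_apply, map_sub, hx, LinearMap.mem_ker.1 hc, sub_zero]

/-- Homogeneous coordinates of the point `s` of the projective line over `K`. -/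
def lineCoord {K : Type*} (L : Type*) [Field K] [Field L] [Algebra K L] : Option K → L × L
  | none => (0, 1)
  | some t => (1, algebraMap K L t)

/-- The first basis vectors of four lines of `PG(3, L)`. -/
def lineBaseA (L : Type*) [Field L] : Fin 4 → Fin 4 → L :=
  ![![1, 0, 0, 0], ![0, 0, 1, 0], ![1, 0, 1, 0], ![1, 0, 0, 1]]

/-- The second basis vectors of four lines of `PG(3, L)`. -/
def lineBaseB {L : Type*} [Field L] (b : L) : Fin 4 → Fin 4 → L :=
  ![![0, 1, 0, 0], ![0, 0, 0, 1], ![0, 1, 0, 1], ![0, 1, b, -1]]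

/-- The points over `K` of four lines of `PG(3, L)`. -/
def linePoint {K : Type*} (L : Type*) [Field K] [Field L] [Algebra K L] (b : K)
    (i : Fin 4 × Option K) : Fin 4 → L :=
  (lineCoord L i.2).1 • lineBaseA L i.1 + (lineCoord L i.2).2 • lineBaseB (algebraMap K L b) i.1

section

variable {K L : Type*} [Field K] [Field L] [Algebra K L]

theorem lineCoord_det_ne_zero {s t : Option K} (h : s ≠ t) :
    (lineCoord L s).1 * (lineCoord L t).2 - (lineCoord L s).2 * (lineCoord L t).1 ≠ 0 := by
  rcases s with _ | s <;> rcases t with _ | t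
  · exact absurd rfl h
  · simp [lineCoord]
  · simp [lineCoord]
  · simpa [lineCoord, sub_eq_zero] using Ne.symm h

theorem exists_smul_lineCoord {a₀ a₁ : K} (ha : a₀ ≠ 0 ∨ a₁ ≠ 0) {u₀ u₁ : L}
    (h : algebraMap K L a₀ * u₀ + algebraMap K L a₁ * u₁ = 0) :
    ∃ (s : Option K) (y : L), u₀ = y * (lineCoord L s).1 ∧ u₁ = y * (lineCoord L s).2 := by
  by_cases h₁ : a₁ = 0
  · subst h₁
    have h₀ : algebraMap K L a₀ ≠ 0 := by simpa using ha
    refine ⟨none, u₁, ?_, by simp [lineCoord]⟩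
    simpa [lineCoord, h₀] using h
  · have h₁' : algebraMap K L a₁ ≠ 0 := by simpa using h₁
    refine ⟨some (-a₀ / a₁), u₀, by simp [lineCoord], ?_⟩
    simp only [lineCoord, map_div₀, map_neg]
    field_simp
    linear_combination h

theorem exists_smul_lineCoord_map (c₀ c₁ : K) :
    ∃ (s : Option K) (y : L), algebraMap K L c₀ = y * (lineCoord L s).1 ∧
      algebraMap K L c₁ = y * (lineCoord L s).2 := by
  by_cases h : c₀ = 0 ∧ c₁ = 0
  · exact ⟨none, 0, by simp [h.1], by simp [h.2]⟩
  · refine exists_smul_lineCoord (a₀ := -c₁) (a₁ := c₀) (by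
      simpa [or_iff_not_imp_left, and_comm, imp_not_comm] using h) ?_
    rw [map_neg]
    ring

theorem linePoint_mem_range (b : K) (i : Fin 4 × Option K) (j : Fin 4) :
    ∃ a : K, algebraMap K L a = linePoint L b i j := by
  obtain ⟨k, s⟩ := i
  rw [← RingHom.mem_range]
  have hc : (lineCoord L s).1 ∈ (algebraMap K L).range ∧
      (lineCoord L s).2 ∈ (algebraMap K L).range := by
    cases s <;> simp [lineCoord]
  have hA : lineBaseA L k j ∈ (algebraMap K L).range := by
    fin_cases k <;> fin_cases j <;> simp [lineBaseA, zero_mem, one_mem]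
  have hB : lineBaseB (algebraMap K L b) k j ∈ (algebraMap K L).range := by
    fin_cases k <;> fin_cases j <;> simp [lineBaseB, zero_mem, one_mem]
  exact add_mem (mul_mem hc.1 hA) (mul_mem hc.2 hB)

/-- `x` is a combination with nonzero coefficients of three distinct members of `h`. -/
def IsTripleComb {ι V : Type*} [AddCommGroup V] [Module L V] (h : ι → V) (x : V) : Prop :=
  ∃ (i : Fin 3 → ι) (c : Fin 3 → L), Function.Injective i ∧ (∀ t, c t ≠ 0) ∧
    ∑ t, c t • h (i t) = x

theorem IsTripleComb.mk {ι V : Type*} [AddCommGroup V] [Module L V] {h : ι → V} {x : V}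
    {i j l : ι} {a b c : L} (hij : i ≠ j) (hil : i ≠ l) (hjl : j ≠ l) (ha : a ≠ 0) (hb : b ≠ 0)
    (hc : c ≠ 0) (hx : a • h i + b • h j + c • h l = x) : IsTripleComb (L := L) h x := by
  refine ⟨![i, j, l], ![a, b, c], ?_, ?_, ?_⟩
  · intro s t
    fin_cases s <;> fin_cases t <;> simp_all [eq_comm]
  · intro t
    fin_cases t <;> simp [ha, hb, hc]
  · simpa [Fin.sum_univ_three] using hx

theorem exists_line_relation (hK : 2 ≤ Nat.card K) [Finite K] (b : K) (k : Fin 4) {s s' : Option K}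
    (h : s ≠ s') : ∃ (s'' : Option K) (d d' d'' : L), s ≠ s'' ∧ s' ≠ s'' ∧ d ≠ 0 ∧ d' ≠ 0 ∧
      d'' ≠ 0 ∧ d • linePoint L b (k, s) + d' • linePoint L b (k, s') +
        d'' • linePoint L b (k, s'') = 0 := by
  classical
  have := Fintype.ofFinite K
  obtain ⟨s'', -, hs⟩ := Finset.exists_mem_notMem_of_card_lt_card
    (s := ({s, s'} : Finset (Option K))) (t := Finset.univ) (by
      rw [Nat.card_eq_fintype_card] at hK
      rw [Finset.card_pair h, Finset.card_univ, Fintype.card_option]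
      omega)
  simp only [Finset.mem_insert, Finset.mem_singleton, not_or] at hs
  refine ⟨s'', _, _, _, Ne.symm hs.1, Ne.symm hs.2, lineCoord_det_ne_zero (Ne.symm hs.2),
    lineCoord_det_ne_zero hs.1, lineCoord_det_ne_zero h, ?_⟩
  simp only [linePoint]
  module

variable [Finite K] [Fintype L]

theorem isTripleComb_same_line (hK : 2 ≤ Nat.card K) (hL : 4 ≤ Fintype.card L) (b : K) (k : Fin 4)
    {s s' : Option K} (h : s ≠ s') (x y : L) :
    IsTripleComb (L := L) (linePoint L b)
      (x • linePoint L b (k, s) + y • linePoint L b (k, s')) := by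
  classical
  obtain ⟨s'', d, d', d'', h1, h2, hd, hd', hd'', hrel⟩ := exists_line_relation (L := L) hK b k h
  obtain ⟨c, -, hc⟩ := Finset.exists_mem_notMem_of_card_lt_card
    (s := ({0, -x / d, -y / d'} : Finset L)) (t := Finset.univ)
    (Finset.card_le_three.trans_lt (by rw [Finset.card_univ]; omega))
  simp only [Finset.mem_insert, Finset.mem_singleton, not_or] at hc
  obtain ⟨h0, hx, hy⟩ := hc
  refine .mk (i := (k, s)) (j := (k, s')) (l := (k, s'')) (a := x + c * d) (b := y + c * d')
    (c := c * d'') (by simpa) (by simpa) (by simpa) ?_ ?_ (mul_ne_zero h0 hd'') ?_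
  · intro h; apply hx; rw [eq_div_iff hd]; linear_combination h
  · intro h; apply hy; rw [eq_div_iff hd']; linear_combination h
  · linear_combination (norm := module) c • hrel

theorem isTripleComb_pair (hK : 2 ≤ Nat.card K) (hL : 4 ≤ Fintype.card L) (b : K)
    {i j : Fin 4 × Option K} (h : i ≠ j) (x y : L) :
    IsTripleComb (L := L) (linePoint L b) (x • linePoint L b i + y • linePoint L b j) := by
  have single : ∀ (i : Fin 4 × Option K) (x : L),
      IsTripleComb (L := L) (linePoint L b) (x • linePoint L b i) := by
    rintro ⟨k, s⟩ x
    obtain ⟨s', hs⟩ := exists_ne s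
    simpa using isTripleComb_same_line hK hL b k hs.symm x 0
  by_cases hx : x = 0
  · simpa [hx] using single j y
  by_cases hy : y = 0
  · simpa [hy] using single i x
  obtain ⟨k, s⟩ := i
  obtain ⟨l, t⟩ := j
  by_cases hkl : k = l
  · subst hkl
    exact isTripleComb_same_line hK hL b k (by simpa using h) x y
  obtain ⟨s', hs⟩ := exists_ne s
  obtain ⟨s'', d, d', d'', h1, h2, hd, hd', hd'', hrel⟩ :=
    exists_line_relation (L := L) hK b k hs.symm
  refine .mk (i := (k, s')) (j := (k, s'')) (l := (l, t)) (a := -(x / d) * d')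
    (b := -(x / d) * d'') (c := y) (by simpa) (by simp [hkl]) (by simp [hkl]) ?_ ?_ hy ?_
  · simp [hx, hd, hd']
  · simp [hx, hd, hd'']
  · have hxd : x = x / d * d := by field_simp
    rw [show x • linePoint L b (k, s) = (x / d * d) • linePoint L b (k, s) by rw [← hxd]]
    linear_combination (norm := module) -(x / d) • hrel

theorem isTripleComb_triple (hK : 2 ≤ Nat.card K) (hL : 4 ≤ Fintype.card L) (b : K)
    {i j l : Fin 4 × Option K} (hij : i ≠ j) (hil : i ≠ l) (hjl : j ≠ l) (x y z : L) :
    IsTripleComb (L := L) (linePoint L b)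
      (x • linePoint L b i + y • linePoint L b j + z • linePoint L b l) := by
  by_cases hx : x = 0
  · simpa [hx] using isTripleComb_pair hK hL b hjl y z
  by_cases hy : y = 0
  · simpa [hy] using isTripleComb_pair hK hL b hil x z
  by_cases hz : z = 0
  · simpa [hz] using isTripleComb_pair hK hL b hij x y
  exact .mk hij hil hjl hx hy hz rfl

/-- The four lines meet every plane over `K` in a spanning set, so each vector lying in such a
plane is a combination of three points. -/
theorem isTripleComb_linePoint_of_plane (hK : 2 ≤ Nat.card K) (hL : 4 ≤ Fintype.card L) {b : K}
    (hb : ∀ t : K, t ^ 2 + t ≠ b) (x : Fin 4 → L) (g : Fin 4 → K) (hg : g ≠ 0)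
    (hgx : ∑ j, algebraMap K L (g j) * x j = 0) :
    IsTripleComb (L := L) (linePoint L b) x := by
  rw [Fin.sum_univ_four] at hgx
  obtain ⟨x₀, hx₀⟩ : ∃ y, x 0 = y := ⟨_, rfl⟩
  obtain ⟨x₁, hx₁⟩ : ∃ y, x 1 = y := ⟨_, rfl⟩
  obtain ⟨x₂, hx₂⟩ : ∃ y, x 2 = y := ⟨_, rfl⟩
  obtain ⟨x₃, hx₃⟩ : ∃ y, x 3 = y := ⟨_, rfl⟩
  have hx : x = ![x₀, x₁, x₂, x₃] := by
    ext j; fin_cases j <;> simp [hx₀, hx₁, hx₂, hx₃]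
  rw [hx₀, hx₁, hx₂, hx₃] at hgx
  by_cases ha : g 0 = 0 ∧ g 1 = 0
  · have hb' : g 2 ≠ 0 ∨ g 3 ≠ 0 := by
      by_contra! hcon
      apply hg
      ext j; fin_cases j <;> simp [ha, hcon]
    obtain ⟨s, y, h₂, h₃⟩ := exists_smul_lineCoord (L := L) hb' (u₀ := x₂) (u₁ := x₃)
      (by simpa [ha.1, ha.2] using hgx)
    convert isTripleComb_triple hK hL b (i := (0, some 0)) (j := (0, none)) (l := (1, s))
      (by simp) (by simp) (by simp) x₀ x₁ y using 1
    rw [hx]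
    ext j; fin_cases j <;> simp [linePoint, lineBaseA, lineBaseB, lineCoord, h₂, h₃]
  rw [not_and_or] at ha
  obtain ⟨Δ, hΔ⟩ : ∃ D, g 0 * g 3 - g 1 * g 2 = D := ⟨_, rfl⟩
  have hΔL := congrArg (algebraMap K L) hΔ
  simp only [map_sub, map_mul] at hΔL
  by_cases hdet : Δ = 0
  · obtain ⟨t, h₂, h₃⟩ : ∃ t, g 2 = t * g 0 ∧ g 3 = t * g 1 := by
      rw [hdet] at hΔ
      by_cases h0 : g 0 = 0
      · have h1 : g 1 ≠ 0 := by simpa [h0] using ha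
        refine ⟨g 3 / g 1, ?_, by field_simp⟩
        simpa [h0, h1] using hΔ
      · refine ⟨g 2 / g 0, by field_simp, ?_⟩
        field_simp
        linear_combination hΔ
    obtain ⟨N, hN⟩ : ∃ N, b * g 0 ^ 2 - g 0 * g 1 - g 1 ^ 2 = N := ⟨_, rfl⟩
    have hN0 : N ≠ 0 := by
      rintro rfl
      by_cases h0 : g 0 = 0
      · simp [h0] at hN
        simp [h0, hN] at ha
      · apply hb (g 1 / g 0)
        field_simp
        linear_combination -hN
    have hNL := congrArg (algebraMap K L) hN
    have hNL0 : algebraMap K L N ≠ 0 := by simpa using hN0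
    simp only [map_sub, map_mul, map_pow] at hNL
    rw [h₂, h₃] at hgx
    simp only [map_mul] at hgx
    obtain ⟨s₃, y₃, hs₃, ht₃⟩ := exists_smul_lineCoord_map (L := L)
      (-(g 1 + t * (b * g 0 - g 1))) (g 0 + t * g 1)
    simp only [map_neg, map_add, map_sub, map_mul] at hs₃ ht₃
    generalize hν : (algebraMap K L (g 0) * x₂ + algebraMap K L (g 1) * x₃) / algebraMap K L N = ν
    rw [div_eq_iff hNL0] at hν
    obtain ⟨s₁, y₁, hs₁, ht₁⟩ := exists_smul_lineCoord (L := L) ha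
      (u₀ := x₀ - ν * (y₃ * (lineCoord L s₃).1)) (u₁ := x₁ - ν * (y₃ * (lineCoord L s₃).2)) (by
        rw [← hs₃, ← ht₃]
        linear_combination hgx - algebraMap K L t * hν + ν * algebraMap K L t * hNL)
    obtain ⟨s₂, y₂, hs₂, ht₂⟩ := exists_smul_lineCoord (L := L) ha
      (u₀ := x₂ - ν * (algebraMap K L b * (y₃ * (lineCoord L s₃).2)))
      (u₁ := x₃ - ν * (y₃ * (lineCoord L s₃).1 - y₃ * (lineCoord L s₃).2)) (by
        rw [← hs₃, ← ht₃]
        linear_combination hν - ν * hNL)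
    convert isTripleComb_triple hK hL b (i := (0, s₁)) (j := (1, s₂)) (l := (3, s₃))
      (by simp) (by simp) (by simp) y₁ y₂ (ν * y₃) using 1
    rw [hx]
    ext j
    fin_cases j <;> simp [linePoint, lineBaseA, lineBaseB]
    · linear_combination hs₁
    · linear_combination ht₁
    · linear_combination hs₂
    · linear_combination ht₂
  · have hΔ0 : algebraMap K L Δ ≠ 0 := by simpa using hdet
    have hb' : g 2 ≠ 0 ∨ g 3 ≠ 0 := by
      by_contra! hcon
      apply hdet
      simp [← hΔ, hcon]
    obtain ⟨s₃, y₃, hs₃, ht₃⟩ := exists_smul_lineCoord_map (L := L) (-(g 1 + g 3)) (g 0 + g 2)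
    simp only [map_neg, map_add] at hs₃ ht₃
    generalize hν : -(algebraMap K L (g 0) * x₀ + algebraMap K L (g 1) * x₁) / algebraMap K L Δ = ν
    rw [div_eq_iff hΔ0] at hν
    obtain ⟨s₁, y₁, hs₁, ht₁⟩ := exists_smul_lineCoord (L := L) ha
      (u₀ := x₀ - ν * (y₃ * (lineCoord L s₃).1)) (u₁ := x₁ - ν * (y₃ * (lineCoord L s₃).2)) (by
        rw [← hs₃, ← ht₃]
        linear_combination -hν + ν * hΔL)
    obtain ⟨s₂, y₂, hs₂, ht₂⟩ := exists_smul_lineCoord (L := L) hb'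
      (u₀ := x₂ - ν * (y₃ * (lineCoord L s₃).1)) (u₁ := x₃ - ν * (y₃ * (lineCoord L s₃).2)) (by
        rw [← hs₃, ← ht₃]
        linear_combination hgx + hν - ν * hΔL)
    convert isTripleComb_triple hK hL b (i := (0, s₁)) (j := (1, s₂)) (l := (2, s₃))
      (by simp) (by simp) (by simp) y₁ y₂ (ν * y₃) using 1
    rw [hx]
    ext j
    fin_cases j <;> simp [linePoint, lineBaseA, lineBaseB]
    · linear_combination hs₁
    · linear_combination ht₁
    · linear_combination hs₂
    · linear_combination ht₂

theorem isTripleComb_linePoint (hK : 2 ≤ Nat.card K) (hL : 4 ≤ Fintype.card L)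
    (hdim : Module.finrank K L = 3) {b : K} (hb : ∀ t : K, t ^ 2 + t ≠ b) (x : Fin 4 → L) :
    IsTripleComb (L := L) (linePoint L b) x := by
  have hli : ¬ LinearIndependent K x := fun h => by
    simpa [hdim] using h.fintype_card_le_finrank
  rw [Fintype.not_linearIndependent_iff] at hli
  obtain ⟨g, hgx, i, hi⟩ := hli
  refine isTripleComb_linePoint_of_plane hK hL hb x g (fun h => hi (by simp [h])) ?_
  simpa [Algebra.smul_def] using hgx

end

/-- If all coordinates of the vectors `h i` lie in the subfield `K`, a vector three of whose
coordinates are independent over `K` is not a combination of fewer than three of the `h i`. -/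
theorem card_le_hammingNorm_of_linearIndependent {K L ι κ m : Type*} [Field K] [Field L]
    [DecidableEq L] [Algebra K L] [Fintype ι] [Fintype κ] {h : ι → m → L}
    (hK : ∀ i j, ∃ a : K, algebraMap K L a = h i j) {x : m → L} {f : κ → m}
    (hx : LinearIndependent K (x ∘ f)) {c : ι → L} (hc : ∑ i, c i • h i = x) :
    Fintype.card κ ≤ hammingNorm c := by
  classical
  set S : Finset L := (Finset.univ.filter fun i => c i ≠ 0).image c with hS
  have hmem : ∀ k, x (f k) ∈ Submodule.span K (S : Set L) := by
    intro k
    rw [← hc, Finset.sum_apply]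
    refine Submodule.sum_mem _ fun i _ => ?_
    obtain ⟨a, ha⟩ := hK i (f k)
    by_cases h0 : c i = 0
    · simp [h0]
    rw [Pi.smul_apply, ← ha, smul_eq_mul, mul_comm, ← Algebra.smul_def]
    refine Submodule.smul_mem _ _ (Submodule.subset_span ?_)
    simp only [hS, Finset.coe_image, Finset.coe_filter, Finset.mem_univ, true_and]
    exact ⟨i, h0, rfl⟩
  have hle : Submodule.span K (Set.range (x ∘ f)) ≤ Submodule.span K (S : Set L) :=
    Submodule.span_le.2 (by rintro _ ⟨k, rfl⟩; exact hmem k)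
  have h1 := Submodule.finrank_mono hle
  rw [finrank_span_eq_card hx] at h1
  exact h1.trans ((finrank_span_finset_le_card S).trans Finset.card_image_le)

theorem exists_sum_mul_pow_eq {M : Type*} [Field M] {n : ℕ} {v : Fin n → M}
    (hv : Function.Injective v) (y : Fin n → M) :
    ∃ z : Fin n → M, ∀ k : Fin n, ∑ t, z t * v t ^ (k : ℕ) = y k := by
  have hdet : IsUnit (Matrix.vandermonde v) := by
    rw [Matrix.isUnit_iff_isUnit_det, isUnit_iff_ne_zero]
    exact Matrix.det_vandermonde_ne_zero_iff.2 hv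
  obtain ⟨z, hz⟩ := Matrix.vecMul_surjective_iff_isUnit.2 hdet y
  exact ⟨z, fun k => by simpa [Matrix.vecMul, dotProduct] using congrFun hz k⟩

/-- Concatenation of the points of four lines of `PG(3, L)`, defined over `K`, with Vandermonde
blocks over an extension `M` of `L`. -/
theorem existsCovCode_of_tower {K L M : Type*} [Field K] [Field L] [Field M] [Algebra K L]
    [Algebra L M] [Finite K] [Fintype L] [DecidableEq L] [Finite M]
    (hKL : Module.finrank K L = 3) (hL : 4 ≤ Fintype.card L)
    (hM : 4 * (Nat.card K + 1) ≤ Nat.card M) :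
    ExistsCovCode L (4 * (Nat.card K + 1) * Nat.card M) (4 + 3 * Module.finrank L M) 3 := by
  classical
  have := Fintype.ofFinite K
  have := Fintype.ofFinite M
  have hK : 2 ≤ Nat.card K := Finite.one_lt_card
  have : FiniteDimensional L M := .of_finite
  obtain ⟨b, hb⟩ : ∃ b : K, ∀ t : K, t ^ 2 + t ≠ b := by
    by_contra! hcon
    have hinj := Finite.injective_iff_surjective.2 (show Function.Surjective fun t : K => t ^ 2 + t from hcon)
    have := @hinj 0 (-1) (by simp)
    simp [eq_comm] at this
  have hcard : Fintype.card (Fin 4 × Option K) = 4 * (Nat.card K + 1) := by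
    simp [Nat.card_eq_fintype_card]
  obtain ⟨lab⟩ : Nonempty (Fin 4 × Option K ↪ M) :=
    Function.Embedding.nonempty_of_card_le (by rwa [hcard, ← Nat.card_eq_fintype_card])
  let e : Fin (4 * (Nat.card K + 1) * Nat.card M) ≃ (Fin 4 × Option K) × M :=
    (Fintype.equivFinOfCardEq (by
      rw [Fintype.card_prod, hcard, Nat.card_eq_fintype_card (α := M)])).symm
  refine existsCovCode_of_columns (V := (Fin 4 → L) × (Fin 3 → M)) (by
    rw [Module.finrank_prod, Module.finrank_fin_fun, Module.finrank_pi_fintype]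
    simp)
    (fun j => (linePoint L b (e j).1, fun k => (e j).2 * lab (e j).1 ^ (k : ℕ))) ?_ ?_
  · rintro ⟨x, y⟩
    obtain ⟨i, c, hi, hc, hx⟩ := isTripleComb_linePoint hK hL hKL hb x
    obtain ⟨z, hz⟩ := exists_sum_mul_pow_eq (lab.injective.comp hi) y
    refine ⟨fun t => e.symm (i t, (c t)⁻¹ • z t), c, Prod.ext ?_ (funext fun k => ?_)⟩
    · simpa [Prod.fst_sum] using hx
    · simp only [Equiv.apply_symm_apply, Prod.snd_sum, Finset.sum_apply, Prod.smul_snd,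
        Pi.smul_apply]
      rw [← hz k]
      refine Finset.sum_congr rfl fun t _ => ?_
      rw [← smul_mul_assoc, smul_inv_smul₀ (hc t), Function.comp_apply]
  · have : FiniteDimensional K L := .of_finite
    let w := Module.finBasisOfFinrankEq K L hKL
    refine ⟨(Fin.snoc (α := fun _ => L) w 0, 0), fun c hc => ?_⟩
    have hfst := congrArg Prod.fst hc
    rw [Prod.fst_sum] at hfst
    simpa using card_le_hammingNorm_of_linearIndependent (K := K) (f := Fin.castSucc)
      (h := fun j => linePoint L b (e j).1) (fun j => linePoint_mem_range b (e j).1)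
      (by simpa [Function.comp_def] using w.linearIndependent) hfst

/-- Theorem 21. For `q = q'^3 ≥ 64` and every `r ≥ 7`, `r ≡ 1 (mod 3)`,
there is an `[n, n-r]_q` code of covering radius `3` with `n = 4q'^{r-3} + 4q'^{r-4}`. -/
theorem statement15 (q' : ℕ) (hq' : IsPrimePow q') (h4 : 4 ≤ q')
    (L : Type*) [Field L] [Fintype L] [DecidableEq L]
    (hL : Fintype.card L = q' ^ 3)
    (r : ℕ) (hr : 7 ≤ r) (hmod : r % 3 = 1) :
    ExistsCovCode L (4 * q' ^ (r - 3) + 4 * q' ^ (r - 4)) r 3 := by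
  obtain ⟨p, k, hp, hk, rfl⟩ := (isPrimePow_nat_iff _).1 hq'
  have : Fact p.Prime := ⟨hp⟩
  have hK : Nat.card (GaloisField p k) = p ^ k := GaloisField.card p k hk.ne'
  have : Finite (GaloisField p k) := Nat.finite_of_card_ne_zero (by rw [hK]; omega)
  have := Fintype.ofFinite (FiniteField.Extension (GaloisField p k) p 3)
  let σ : FiniteField.Extension (GaloisField p k) p 3 ≃+* L := FiniteField.ringEquivOfCardEq (by
    rw [hL, ← hK, ← FiniteField.natCard_extension (GaloisField p k) p 3,
      Nat.card_eq_fintype_card])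
  let : Algebra (GaloisField p k) L :=
    (σ.toRingHom.comp (algebraMap (GaloisField p k) _)).toAlgebra
  have hdim : Module.finrank (GaloisField p k) L = 3 := by
    have h := Module.natCard_eq_pow_finrank (K := GaloisField p k) (V := L)
    rw [Nat.card_eq_fintype_card, hL, hK] at h
    exact (Nat.pow_right_injective (by omega : 2 ≤ p ^ k) h).symm
  have : CharP L p := charP_of_injective_algebraMap (algebraMap (GaloisField p k) L).injective p
  obtain ⟨m, hm, rfl⟩ : ∃ m, 1 ≤ m ∧ r = 4 + 3 * m := ⟨(r - 4) / 3, by omega, by omega⟩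
  have : NeZero m := ⟨by omega⟩
  have hM : Nat.card (FiniteField.Extension L p m) = (p ^ k) ^ (3 * m) := by
    rw [FiniteField.natCard_extension, Nat.card_eq_fintype_card, hL, pow_mul]
  have : Finite (FiniteField.Extension L p m) := Module.finite_of_finite L
  have hle : (p ^ k) ^ 3 ≤ (p ^ k) ^ (3 * m) := Nat.pow_le_pow_right (by omega) (by omega)
  have key := existsCovCode_of_tower (M := FiniteField.Extension L p m) hdim
    (by rw [hL]; nlinarith [Nat.pow_le_pow_left h4 3])
    (by rw [hM, hK]; refine le_trans ?_ hle; nlinarith [sq_nonneg (p ^ k)])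
  rw [FiniteField.finrank_extension, hK, hM] at key
  convert key using 1
  rw [show 4 + 3 * m - 3 = 3 * m + 1 by omega, show 4 + 3 * m - 4 = 3 * m by omega, pow_succ]
  ring
end
end

section
/- Let q' ≥ 3 be a prime power and let q = (q')^3 (so q ≥ 27). Then for every integer r ≥ 8 with r ≡ 2 (mod 3) there exists a linear [n, n−r]_q code with covering radius 3, where n = 9(q')^{r−3} − 8(q')^{r−4} + 4(q')^{r−5}; that is, n = (9 − 8/q^{1/3} + 4/q^{2/3})·q^{(r−3)/3}. -/
noncomputable section

/-- A vector of Hamming weight at most two is a sum of two coordinate vectors. -/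
lemma exists_single_add_single_of_hammingNorm_le_two {F : Type*} [Field F] [DecidableEq F]
    {n : ℕ} [NeZero n] (e : Fin n → F) (he : hammingNorm e ≤ 2) :
    ∃ (i j : Fin n) (a b : F), e = Pi.single i a + Pi.single j b := by
  obtain ⟨s, hs, hcard⟩ : ∃ s : Finset (Fin n),
      (Finset.univ.filter fun k => e k ≠ 0) = s ∧ s.card ≤ 2 := ⟨_, rfl, he⟩
  have hzero : ∀ k, k ∉ s → e k = 0 := fun k hk => by
    by_contra h
    exact hk (hs ▸ by simpa using h)
  interval_cases h : s.card
  · rw [Finset.card_eq_zero] at h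
    subst h
    exact ⟨0, 0, 0, 0, by ext k; simp [hzero k (by simp)]⟩
  · obtain ⟨i, rfl⟩ := Finset.card_eq_one.mp h
    refine ⟨i, i, e i, 0, ?_⟩
    ext k
    by_cases hk : k = i
    · subst hk; simp
    · simp [hk, hzero k (by simpa using hk)]
  · obtain ⟨i, j, hij, rfl⟩ := Finset.card_eq_two.mp h
    refine ⟨i, j, e i, e j, ?_⟩
    ext k
    by_cases hi : k = i
    · subst hi; simp [hij]
    · by_cases hj : k = j
      · subst hj; simp [hi]
      · simp [hi, hj, hzero k (by simp [hi, hj])]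

/-- If every vector of an `r`-dimensional space is a combination of three members of a family of
at most `n` vectors, and combinations of two of `n` vectors are too few to fill the space, then
there is an `[n, n-r]` code of covering radius `3`. -/
lemma existsCovCode_three_of_columns {F V ι : Type*} [Field F] [Fintype F] [DecidableEq F]
    [AddCommGroup V] [Module F V] [FiniteDimensional F V] [Fintype ι] {n r : ℕ}
    (hV : Module.finrank F V = r) (col : ι → V) (hn : Fintype.card ι ≤ n)
    (cov : ∀ v : V, ∃ (i : Fin 3 → ι) (a : Fin 3 → F), ∑ k, a k • col (i k) = v)
    (hcount : n ^ 2 * Fintype.card F ^ 2 < Fintype.card F ^ r) :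
    ExistsCovCode F n r 3 := by
  obtain ⟨emb⟩ : Nonempty (ι ↪ Fin n) :=
    Function.Embedding.nonempty_of_card_le (by simpa using hn)
  have : NeZero n := by
    obtain ⟨i, -, -⟩ := cov 0
    exact ⟨fun h => by subst h; exact (emb (i 0)).elim0⟩
  set H : (Fin n → F) →ₗ[F] V := Fintype.linearCombination F (Function.extend emb col 0)
    with hH
  have hsingle : ∀ j a, H (Pi.single j a) = a • Function.extend emb col 0 j := fun j a => by
    simp [hH, Fintype.linearCombination_apply_single]
  have hlift : ∀ v : V, ∃ e : Fin n → F, H e = v ∧ hammingNorm e ≤ 3 := by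
    intro v
    obtain ⟨i, a, rfl⟩ := cov v
    refine ⟨∑ k, Pi.single (emb (i k)) (a k), ?_, ?_⟩
    · simp [hsingle, emb.injective.extend_apply]
    · have hsub : (Finset.univ.filter fun j =>
          (∑ k, Pi.single (emb (i k)) (a k) : Fin n → F) j ≠ 0) ⊆
          Finset.univ.image fun k => emb (i k) := by
        intro j hj
        rw [Finset.mem_filter, Finset.sum_apply] at hj
        obtain ⟨k, -, hk⟩ := Finset.exists_ne_zero_of_sum_ne_zero hj.2
        refine Finset.mem_image.mpr ⟨k, Finset.mem_univ _, ?_⟩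
        by_contra hne
        exact hk (Pi.single_eq_of_ne (Ne.symm hne) _)
      exact (Finset.card_le_card hsub).trans (Finset.card_image_le.trans (by simp))
  have hsurj : LinearMap.range H = ⊤ := LinearMap.range_eq_top.mpr fun v =>
    let ⟨e, he, _⟩ := hlift v; ⟨e, he⟩
  have hrank := H.finrank_range_add_finrank_ker
  rw [hsurj, finrank_top, hV, Module.finrank_fin_fun] at hrank
  refine ⟨by omega, LinearMap.ker H, by omega, fun x => ?_, ?_⟩
  · obtain ⟨e, he, hw⟩ := hlift (H x)
    refine ⟨x - e, by simp [he], ?_⟩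
    rw [hammingDist_comm, hammingDist_eq_hammingNorm]
    simpa using hw
  · by_contra! hcon
    let f : (Fin n × Fin n) × (F × F) → V := fun p =>
      H (Pi.single p.1.1 p.2.1 + Pi.single p.1.2 p.2.2)
    have hf : Function.Surjective f := by
      intro v
      obtain ⟨x, rfl⟩ := LinearMap.range_eq_top.mp hsurj v
      obtain ⟨c, hc, hd⟩ := hcon x
      rw [hammingDist_comm, hammingDist_eq_hammingNorm] at hd
      obtain ⟨i, j, a, b, he⟩ :=
        exists_single_add_single_of_hammingNorm_le_two _ (Nat.le_of_lt_succ hd)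
      refine ⟨((i, j), (a, b)), ?_⟩
      simp only [f]
      rw [← he, map_add, map_neg, LinearMap.mem_ker.mp hc, neg_zero, zero_add]
    have hle := Nat.card_le_card_of_surjective f hf
    rw [Module.natCard_eq_pow_finrank (K := F) (V := V), hV] at hle
    simp only [Nat.card_eq_fintype_card, Fintype.card_prod, Fintype.card_fin] at hle
    nlinarith

/-- Three linearly independent functionals on a three-dimensional space take any prescribed
values simultaneously. -/
lemma exists_forall_apply_eq_of_linearIndependent {K V : Type*} [Field K] [AddCommGroup V]
    [Module K V] [FiniteDimensional K V] (hV : Module.finrank K V = 3)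
    (g : Fin 3 → Module.Dual K V) (hg : LinearIndependent K g) (y : Fin 3 → K) :
    ∃ c : V, ∀ i, g i c = y i := by
  have hinj : Function.Injective (LinearMap.pi g) := by
    rw [injective_iff_map_eq_zero]
    intro c hc
    have hspan := hg.span_eq_top_of_card_eq_finrank (by simp [Subspace.dual_finrank_eq, hV])
    rw [← Module.forall_dual_apply_eq_zero_iff K]
    intro φ
    have hφ : φ ∈ Submodule.span K (Set.range g) := hspan ▸ Submodule.mem_top
    induction hφ using Submodule.span_induction with
    | mem x hx => obtain ⟨i, rfl⟩ := hx; exact congrFun hc i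
    | zero => rfl
    | add x y _ _ hx hy => simp [hx, hy]
    | smul a x _ hx => simp [hx]
  obtain ⟨c, hc⟩ :=
    (LinearMap.injective_iff_surjective_of_finrank_eq_finrank (by simp [hV])).mp hinj y
  exact ⟨c, fun i => congrFun hc i⟩

/-- Given independent families of one, two and three vectors, the choice of a member of each can
be made so that the three members are independent. -/
lemma exists_linearIndependent_choice {K V : Type*} [Field K] [AddCommGroup V] [Module K V]
    (A : Fin 3 → Fin 3 → V) (hA : ∀ i, LinearIndependent K (A i)) :
    ∃ σ : Fin 3 → Fin 3, (∀ i, σ i ≤ i) ∧ LinearIndependent K fun i => A i (σ i) := by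
  have key : ∀ (k : ℕ) (i : Fin 3) (v : Fin k → V), (i : ℕ) = k →
      ∃ j ≤ i, A i j ∉ Submodule.span K (Set.range v) := by
    intro k i v hk
    by_contra! hcon
    have hli : LinearIndependent K fun j : Set.Iic i => A i j :=
      (hA i).comp _ Subtype.val_injective
    have hsub : Submodule.span K (Set.range fun j : Set.Iic i => A i j) ≤
        Submodule.span K (Set.range v) :=
      Submodule.span_le.mpr (by rintro _ ⟨j, rfl⟩; exact hcon j j.2)
    have := FiniteDimensional.span_of_finite K (Set.finite_range v)
    have h1 := Submodule.finrank_mono hsub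
    rw [finrank_span_eq_card hli] at h1
    have h2 := h1.trans (finrank_range_le_card v)
    simp at h2
    omega
  obtain ⟨j₁, h₁, hn₁⟩ := key 1 1 ![A 0 0] rfl
  obtain ⟨j₂, h₂, hn₂⟩ := key 2 2 ![A 1 j₁, A 0 0] rfl
  have hli : LinearIndependent K ![A 2 j₂, A 1 j₁, A 0 0] := by
    refine linearIndependent_finCons.mpr ⟨linearIndependent_finCons.mpr ⟨?_, hn₁⟩, hn₂⟩
    exact LinearIndependent.of_subsingleton 0 ((hA 0).ne_zero 0)
  refine ⟨![0, j₁, j₂], ?_, ?_⟩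
  · intro i
    fin_cases i
    · exact le_rfl
    · exact h₁
    · exact h₂
  · have := hli.comp Fin.rev Fin.rev_injective
    convert this using 1
    ext i
    fin_cases i <;> rfl

/-- Three translated and scaled unions of one, two and three coordinate planes of a cubic
extension always have a common point. -/
lemma exists_coord_sub_mul_eq_zero {K L : Type*} [Field K] [Field L] [Algebra K L]
    (b : Module.Basis (Fin 3) K L) (w : Fin 3 → L) (hw : ∀ i, w i ≠ 0) (y : Fin 3 → L) :
    ∃ (c : L) (σ : Fin 3 → Fin 3), ∀ i, σ i ≤ i ∧ b.coord (σ i) ((y i - c) * w i) = 0 := by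
  have : FiniteDimensional K L := b.finiteDimensional_of_finite
  have hind : ∀ i, LinearIndependent K fun j => (b.coord j).comp (LinearMap.mulRight K (w i)) := by
    intro i
    rw [Fintype.linearIndependent_iff]
    intro a ha j
    have := LinearMap.congr_fun ha (b j * (w i)⁻¹)
    simpa [LinearMap.sum_apply, hw i, Finsupp.single_apply] using this
  obtain ⟨σ, hσ, hli⟩ := exists_linearIndependent_choice _ hind
  obtain ⟨c, hc⟩ := exists_forall_apply_eq_of_linearIndependent
    (Module.finrank_eq_card_basis b) _ hli fun i => b.coord (σ i) (y i * w i)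
  refine ⟨c, σ, fun i => ⟨hσ i, ?_⟩⟩
  rw [sub_mul, map_sub, ← hc i]
  simp

/-- A finite field with `q ^ 3` elements is a cubic extension of a field with `q` elements. -/
lemma exists_cubic_subfield {q : ℕ} (hq : IsPrimePow q) (L : Type*) [Field L] [Fintype L]
    (hL : Fintype.card L = q ^ 3) :
    ∃ (K : Type) (_ : Field K) (_ : Fintype K) (_ : Algebra K L),
      Fintype.card K = q ∧ Module.finrank K L = 3 := by
  obtain ⟨p, k, hp, hk, rfl⟩ := (isPrimePow_nat_iff q).mp hq
  have : Fact p.Prime := ⟨hp⟩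
  have hchar : CharP L p := by
    obtain ⟨s, hs⟩ := CharP.exists L
    obtain ⟨n, hsp, hn⟩ := FiniteField.card L s
    have : p ∣ s ^ (n : ℕ) := by
      rw [← hn, hL, ← pow_mul]
      exact dvd_pow_self p (by positivity)
    rwa [(Nat.prime_dvd_prime_iff_eq hp hsp).mp (hp.dvd_of_dvd_pow this)]
  let _ : Algebra (ZMod p) L := ZMod.algebra L p
  have hfin : Module.finrank (ZMod p) L = k * 3 := by
    have h := FiniteField.pow_finrank_eq_card p L
    rw [hL, ← pow_mul] at h
    exact Nat.pow_right_injective hp.two_le h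
  obtain ⟨φ⟩ : Nonempty (GaloisField p k →ₐ[ZMod p] L) :=
    FiniteField.nonempty_algHom_of_finrank_dvd
      (by rw [GaloisField.finrank p hk.ne', hfin]; exact dvd_mul_right k 3)
  let _ : Fintype (GaloisField p k) := Fintype.ofFinite _
  let _ : Algebra (GaloisField p k) L := φ.toRingHom.toAlgebra
  have hcard : Fintype.card (GaloisField p k) = p ^ k := by
    rw [← Nat.card_eq_fintype_card, GaloisField.card p k hk.ne']
  refine ⟨GaloisField p k, inferInstance, inferInstance, inferInstance, hcard, ?_⟩
  have h := Module.card_eq_pow_finrank (K := GaloisField p k) (V := L)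
  rw [hL, hcard] at h
  exact (Nat.pow_right_injective (hp.two_le.trans (Nat.le_self_pow hk.ne' p)) h).symm

/-- The family of columns of the parity-check matrix: for each block `i`, multiples of `h i` by
elements of the first `i + 1` coordinate planes (with respect to `b`) paired with projective
points of the `i`-th block, together with the vectors `h i` themselves. -/
def planeColumn {K L : Type*} [Field K] [Field L] [Algebra K L]
    (b : Module.Basis (Fin 3) K L) (m : ℕ) (h : Fin 3 → Fin 2 → L) :
    ({ij : Fin 3 × Fin 3 // ij.2 ≤ ij.1} × Projectivization L (Fin m → L) × (Fin 2 → K)) ⊕ Fin 3 →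
      (Fin 2 → L) × (Fin 3 → Fin m → L)
  | .inl (ij, p, u) => (b.equivFun.symm (ij.1.2.insertNth 0 u) • h ij.1.1, Pi.single ij.1.1 p.rep)
  | .inr i => (h i, 0)

lemma exists_sum_planeColumn_eq {K L : Type*} [Field K] [Field L] [Algebra K L]
    (b : Module.Basis (Fin 3) K L) (m : ℕ) (v : (Fin 2 → L) × (Fin 3 → Fin m → L)) :
    ∃ (i : Fin 3 → _) (a : Fin 3 → L),
      ∑ k, a k • planeColumn b m ![![1, 0], ![0, 1], ![-1, -1]] (i k) = v := by
  set h : Fin 3 → Fin 2 → L := ![![1, 0], ![0, 1], ![-1, -1]]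
  obtain ⟨x, z⟩ := v
  have hrep : ∀ k, ∃ t : L, t ≠ 0 ∧
      (z k ≠ 0 → ∃ p : Projectivization L (Fin m → L), t • p.rep = z k) := by
    intro k
    by_cases hz : z k = 0
    · exact ⟨1, one_ne_zero, fun h => absurd hz h⟩
    · obtain ⟨a, ha⟩ := Projectivization.exists_smul_eq_mk_rep L (z k) hz
      refine ⟨((a⁻¹ : Lˣ) : L), Units.ne_zero _, fun _ => ⟨Projectivization.mk L (z k) hz, ?_⟩⟩
      rw [← ha]
      simp [Units.smul_def]
  choose t ht hp using hrep
  obtain ⟨c, σ, hc⟩ := exists_coord_sub_mul_eq_zero b (fun k => (t k)⁻¹)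
    (fun k => inv_ne_zero (ht k)) ![x 0, x 1, 0]
  have hcol : ∀ k, ∃ (i : _) (a : L), a • planeColumn b m h i =
      (((![x 0, x 1, 0] : Fin 3 → L) k - c) • h k, (Pi.single k (z k) : Fin 3 → Fin m → L)) := by
    intro k
    set y := (![x 0, x 1, 0] : Fin 3 → L) k - c
    by_cases hz : z k = 0
    · exact ⟨.inr k, y, by simp [planeColumn, hz]⟩
    · obtain ⟨p, hp⟩ := hp k hz
      obtain ⟨hle, hzero⟩ := hc k
      refine ⟨.inl (⟨(k, σ k), hle⟩, p, (σ k).removeNth (b.equivFun (y * (t k)⁻¹))), t k, ?_⟩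
      have hins : (σ k).insertNth 0 ((σ k).removeNth (b.equivFun (y * (t k)⁻¹))) =
          b.equivFun (y * (t k)⁻¹) := by
        rw [Fin.insertNth_eq_iff]
        exact ⟨hzero.symm, rfl⟩
      simp only [planeColumn, hins, LinearEquiv.symm_apply_apply, Prod.smul_mk, smul_smul,
        ← Pi.single_smul, hp]
      rw [mul_comm y, mul_inv_cancel_left₀ (ht k)]
  choose i a hia using hcol
  refine ⟨i, a, ?_⟩
  simp only [hia, Prod.ext_iff, Prod.fst_sum, Prod.snd_sum]
  refine ⟨?_, Finset.univ_sum_single z⟩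
  ext l
  fin_cases l <;> simp [h, Fin.sum_univ_three]

lemma card_planeColumn_index_le {Q N A B : ℕ} (hQ : 3 ≤ Q) (hA : 1 ≤ A)
    (hN : N * (Q ^ 3 - 1) + 1 = Q ^ 3 * A) (hB : B = 9 * (A * Q ^ 2) - 8 * (A * Q) + 4 * A) :
    6 * (N * Q ^ 2) + 3 ≤ B := by
  have hQ3 : 27 ≤ Q ^ 3 := Nat.pow_le_pow_left hQ 3
  obtain ⟨s, hs⟩ : ∃ s, Q ^ 3 = s + 27 := ⟨Q ^ 3 - 27, by omega⟩
  have hNA : 26 * N ≤ 27 * A := by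
    rw [hs, show s + 27 - 1 = s + 26 by omega] at hN
    by_contra! hlt
    nlinarith [Nat.mul_le_mul_left s hlt.le]
  have h8 : 8 * (A * Q) ≤ 9 * (A * Q ^ 2) := by nlinarith [Nat.mul_le_mul_left (A * Q) hQ]
  have h9 : 26 * N * Q ^ 2 ≤ 27 * A * Q ^ 2 := Nat.mul_le_mul_right _ hNA
  have h10 : A * 1 ≤ A * (Q * (Q - 3) + 1) := by gcongr; omega
  zify [h8, hQ] at *
  rw [hB]
  nlinarith

/-- Theorem 23. For `q = q'^3 ≥ 27` and every `r ≥ 8`, `r ≡ 2 (mod 3)`,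
there is an `[n, n-r]_q` code of covering radius `3` with
`n = 9q'^{r-3} - 8q'^{r-4} + 4q'^{r-5}`. -/
theorem statement16 (q' : ℕ) (hq' : IsPrimePow q') (h3 : 3 ≤ q')
    (L : Type*) [Field L] [Fintype L] [DecidableEq L]
    (hL : Fintype.card L = q' ^ 3)
    (r : ℕ) (hr : 8 ≤ r) (hmod : r % 3 = 2) :
    ExistsCovCode L (9 * q' ^ (r - 3) - 8 * q' ^ (r - 4) + 4 * q' ^ (r - 5)) r 3 := by
  
  obtain ⟨K, _, _, _, hK, hrank⟩ := exists_cubic_subfield hq' L hL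
  obtain ⟨m, rfl⟩ : ∃ m, r = 3 * m + 5 := ⟨(r - 5) / 3, by omega⟩
  have : FiniteDimensional K L := Module.finite_of_finrank_eq_succ hrank
  let b : Module.Basis (Fin 3) K L := Module.finBasisOfFinrankEq K L hrank
  have hpos : 0 < q' := by omega
  let _ : Fintype (Projectivization L (Fin (m + 1) → L)) := Fintype.ofFinite _
  refine existsCovCode_three_of_columns (V := (Fin 2 → L) × (Fin 3 → Fin (m + 1) → L)) ?_
    (planeColumn b (m + 1) ![![1, 0], ![0, 1], ![-1, -1]]) ?_
    (exists_sum_planeColumn_eq b (m + 1)) ?_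
  · simp [Module.finrank_prod, Module.finrank_pi_fintype]
    ring
  · have hproj := Projectivization.card' L (Fin (m + 1) → L)
    simp only [Nat.card_eq_fintype_card, Fintype.card_fun, Fintype.card_fin, hL] at hproj
    have hidx : Fintype.card {ij : Fin 3 × Fin 3 // ij.2 ≤ ij.1} = 6 := by decide
    simp only [Fintype.card_sum, Fintype.card_prod, Fintype.card_fun, Fintype.card_fin, hK, hidx]
    refine card_planeColumn_index_le (A := q' ^ (3 * m)) h3 (Nat.one_le_pow _ _ hpos) ?_ ?_
    · rw [← hproj, pow_mul]
      ring
    · rw [← pow_add, ← pow_succ]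
      rfl
  · set n := 9 * q' ^ (3 * m + 5 - 3) - 8 * q' ^ (3 * m + 5 - 4) + 4 * q' ^ (3 * m + 5 - 5)
    have hn : n ≤ 9 * q' ^ (3 * m + 2) := by
      have h1 : q' ^ (3 * m + 1) = q' ^ (3 * m) * q' := pow_succ _ _
      have h2 : q' ^ (3 * m + 2) = q' ^ (3 * m + 1) * q' := pow_succ _ _
      have h4 : 4 * q' ^ (3 * m) ≤ 8 * q' ^ (3 * m + 1) := by
        rw [h1]; nlinarith [Nat.pow_pos (n := 3 * m) hpos]
      have h5 : 8 * q' ^ (3 * m + 1) ≤ 9 * q' ^ (3 * m + 2) := by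
        rw [h2]; nlinarith [Nat.pow_pos (n := 3 * m + 1) hpos]
      simp only [n, show 3 * m + 5 - 3 = 3 * m + 2 by omega,
        show 3 * m + 5 - 4 = 3 * m + 1 by omega, show 3 * m + 5 - 5 = 3 * m by omega]
      omega
    rw [hL]
    calc n ^ 2 * (q' ^ 3) ^ 2 ≤ (9 * q' ^ (3 * m + 2)) ^ 2 * (q' ^ 3) ^ 2 := by gcongr
      _ = 81 * q' ^ (6 * m + 10) := by ring
      _ < q' ^ 5 * q' ^ (6 * m + 10) := by
        gcongr
        exact lt_of_lt_of_le (by norm_num) (Nat.pow_le_pow_left h3 5)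
      _ = q' ^ (6 * m + 15) := by ring
      _ ≤ q' ^ (9 * m + 15) := Nat.pow_le_pow_right hpos (by omega)
      _ = (q' ^ 3) ^ (3 * m + 5) := by ring
end
end
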